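/- Let d be a positive integer and let J ⊊ I be squarefree monomial ideals of S such that I is minimally generated by two squarefree monomials f_1, f_2 of degree d together with a set E of squarefree monomials of degrees ≥ d+1, and J is either 0 or generated by squarefree monomials of degrees ≥ d+1. Suppose that: (1) 4 ≤ s ≤ q+2; (2) C ⊆ ((f_1)∩(f_2)) ∪ ((E)∩(f_1,f_2)) ∪ (∪_{a,a'∈E, a≠a'} (a)∩(a')); (3) there exists b ∈ (B∩(f_1))∖(f_2) such that sdepth_S I_b/J_b ≥ d+2, where I_b = (f_2, B∖{b}) and J_b = J ∩ I_b. Then either sdepth_S I/J ≥ d+2, or there exists a nonzero ideal I' ⊊ I generated by a subset of {f_1, f_2} ∪ B such that sdepth_S I'/J' ≤ d+1 for J' = J ∩ I' and depth_S I/(J + I') ≥ d+1. -/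

import Mathlib

open MvPolynomial

/-- The squarefree monomial `∏_{i ∈ T} x_i` in `K[x_1,…,x_n]`. -/
noncomputable def sqm (K : Type*) [Field K] {n : ℕ} (T : Finset (Fin n)) :
    MvPolynomial (Fin n) K := ∏ i ∈ T, X i

/-- The poset `P_{I \ J}` of (supports of) squarefree monomials of `I \ J`. -/
def sqPoset {K : Type*} [Field K] {n : ℕ} (I J : Ideal (MvPolynomial (Fin n) K)) :
    Set (Finset (Fin n)) :=
  {T | sqm K T ∈ I ∧ sqm K T ∉ J}

/-- The squarefree monomials of degree `k` in `I \ J`. -/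
def degSet {K : Type*} [Field K] {n : ℕ} (I J : Ideal (MvPolynomial (Fin n) K)) (k : ℕ) :
    Set (Finset (Fin n)) :=
  {T ∈ sqPoset I J | T.card = k}

/-- A partition of `P_{I\J}` into intervals `[u,v]`, recorded as a finite set of
pairs `(u, v)`: each monomial of `P_{I\J}` lies in exactly one interval. -/
def IsIntervalPartition {K : Type*} [Field K] {n : ℕ}
    (I J : Ideal (MvPolynomial (Fin n) K))
    (F : Finset (Finset (Fin n) × Finset (Fin n))) : Prop :=
  (∀ p ∈ F, p.1 ∈ sqPoset I J ∧ p.2 ∈ sqPoset I J ∧ p.1 ⊆ p.2) ∧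
  (∀ T ∈ sqPoset I J, ∃! p, p ∈ F ∧ p.1 ⊆ T ∧ T ⊆ p.2)

/-- The Stanley depth of `I/J`: the maximum over interval partitions of the
minimal degree of an upper endpoint. -/
noncomputable def sdepth {K : Type*} [Field K] {n : ℕ}
    (I J : Ideal (MvPolynomial (Fin n) K)) : ℕ :=
  sSup {k | ∃ F, IsIntervalPartition I J F ∧ ∀ p ∈ F, k ≤ p.2.card}

/-- The depth of a module over `K[x_1,…,x_n]` with respect to the maximal ideal
`(x_1,…,x_n)`: the supremum of lengths of regular sequences from `(x_1,…,x_n)`. -/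
noncomputable def mdepth {K : Type*} [Field K] {n : ℕ}
    (M : Type*) [AddCommGroup M] [Module (MvPolynomial (Fin n) K) M] : ℕ :=
  sSup {k | ∃ rs : List (MvPolynomial (Fin n) K), rs.length = k ∧
    (∀ r ∈ rs, r ∈ Ideal.span (Set.range X : Set (MvPolynomial (Fin n) K))) ∧
    RingTheory.Sequence.IsRegular M rs}

/-- The `S`-module `I/J` (more precisely `I/(J ∩ I)`). -/
abbrev quotMod {K : Type*} [Field K] {n : ℕ} (I J : Ideal (MvPolynomial (Fin n) K)) :=
  I ⧸ (Submodule.comap I.subtype J)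

/-- `depth_S I/J`. -/
noncomputable def depthIJ {K : Type*} [Field K] {n : ℕ}
    (I J : Ideal (MvPolynomial (Fin n) K)) : ℕ :=
  mdepth (K := K) (n := n) (quotMod I J)

/-- An ideal is a squarefree monomial ideal generated in degrees `≥ d` if it is
the span of squarefree monomials whose supports have at least `d` elements. -/
def SqfreeGenFrom {K : Type*} [Field K] {n : ℕ}
    (L : Ideal (MvPolynomial (Fin n) K)) (d : ℕ) : Prop :=
  ∃ G : Set (Finset (Fin n)), (∀ T ∈ G, d ≤ T.card) ∧ L = Ideal.span (sqm K '' G)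

/-- A squarefree monomial ideal. -/
def IsSqfreeMonomialIdeal {K : Type*} [Field K] {n : ℕ}
    (L : Ideal (MvPolynomial (Fin n) K)) : Prop :=
  ∃ G : Set (Finset (Fin n)), L = Ideal.span (sqm K '' G)

section ExtDepth

universe u

open CategoryTheory Abelian RingTheory.Sequence Pointwise

/-- All groups `Ext^i(R/𝔪, M)` with `i < k` vanish. -/
def ExtVanishesBelow {R : Type u} [CommRing R] (𝔪 : Ideal R) (M : Type u) [AddCommGroup M]
    [Module R M] (k : ℕ) : Prop :=
  ∀ i < k, Subsingleton (Ext (ModuleCat.of R (R ⧸ 𝔪)) (ModuleCat.of R M) i)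

namespace ExtVanishesBelow

variable {R : Type u} [CommRing R] {𝔪 : Ideal R} {A B C : Type u}
  [AddCommGroup A] [Module R A] [AddCommGroup B] [Module R B] [AddCommGroup C] [Module R C]
  {k : ℕ}

theorem extension {f : A →ₗ[R] B} {g : B →ₗ[R] C} (hf : Function.Injective f)
    (hg : Function.Surjective g) (hfg : Function.Exact f g)
    (hA : ExtVanishesBelow 𝔪 A k) (hC : ExtVanishesBelow 𝔪 C k) : ExtVanishesBelow 𝔪 B k := by
  intro i hi
  let S : ShortComplex (ModuleCat.{u} R) :=
    ModuleCat.shortComplexOfCompEqZero f g hfg.linearMap_comp_eq_zero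
  have hS : S.ShortExact :=
    { exact := ModuleCat.shortComplex_exact _ hfg
      mono_f := (ModuleCat.mono_iff_injective _).mpr hf
      epi_g := (ModuleCat.epi_iff_surjective _).mpr hg }
  have zero1 := AddCommGrpCat.isZero_of_iff_subsingleton.mpr (hA i hi)
  have zero2 := AddCommGrpCat.isZero_of_iff_subsingleton.mpr (hC i hi)
  exact AddCommGrpCat.subsingleton_of_isZero <| ShortComplex.Exact.isZero_of_both_zeros
    (Ext.covariant_sequence_exact₂' (ModuleCat.of R (R ⧸ 𝔪)) hS i)
    (zero1.eq_zero_of_src _) (zero2.eq_zero_of_tgt _)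

theorem of_linearEquiv (e : A ≃ₗ[R] B) (hA : ExtVanishesBelow 𝔪 A k) :
    ExtVanishesBelow 𝔪 B k := by
  intro i hi
  have := hA i hi
  refine ⟨fun x y => ?_⟩
  have key : ∀ z : Ext (ModuleCat.of R (R ⧸ 𝔪)) (ModuleCat.of R B) i,
      (z.comp (Ext.mk₀ e.toModuleIso.inv) (add_zero i)).comp
        (Ext.mk₀ e.toModuleIso.hom) (add_zero i) = z := by
    intro z
    rw [Ext.comp_assoc_of_third_deg_zero, Ext.mk₀_comp_mk₀, Iso.inv_hom_id, Ext.comp_mk₀_id]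
  rw [← key x, ← key y]
  congr 1
  exact Subsingleton.elim _ _

theorem of_smul {x : R} (hx : x ∈ 𝔪) {f : A →ₗ[R] C} (hxr : IsSMulRegular A x)
    (hf : Function.Surjective f) (hker : ∀ a, f a = 0 → ∃ b, a = x • b)
    (hker' : ∀ b, f (x • b) = 0)
    (hC : ExtVanishesBelow 𝔪 C k) : ExtVanishesBelow 𝔪 A (k + 1) := by
  intro i hi
  have hfg : Function.Exact (LinearMap.lsmul R A x) f := fun a =>
    ⟨fun h => by obtain ⟨b, rfl⟩ := hker a h; exact ⟨b, rfl⟩,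
      fun ⟨b, hb⟩ => by rw [← hb]; exact hker' b⟩
  let S : ShortComplex (ModuleCat.{u} R) :=
    ModuleCat.shortComplexOfCompEqZero (LinearMap.lsmul R A x) f hfg.linearMap_comp_eq_zero
  have hS : S.ShortExact :=
    { exact := ModuleCat.shortComplex_exact _ hfg
      mono_f := (ModuleCat.mono_iff_injective _).mpr hxr
      epi_g := (ModuleCat.epi_iff_surjective _).mpr hf }
  have hann : x ∈ Module.annihilator R (ModuleCat.of R (R ⧸ 𝔪)) := by
    change x ∈ Module.annihilator R (R ⧸ 𝔪)
    rwa [Ideal.annihilator_quotient]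
  have hz := Ext.postcomp_smul_id_eq_zero_of_mem_annihilator (M := ModuleCat.of R A) hann i
  have hmono : Mono (AddCommGrpCat.ofHom ((Ext.mk₀ S.f).postcomp
      (ModuleCat.of R (R ⧸ 𝔪)) (add_zero i))) := by
    cases i with
    | zero =>
      rw [AddCommGrpCat.mono_iff_injective]
      have := hS.mono_f
      exact Ext.postcomp_mk₀_injective_of_mono _ _
    | succ i =>
      exact (Ext.covariant_sequence_exact₁' (ModuleCat.of R (R ⧸ 𝔪)) hS i (i + 1) rfl).mono_g
        ((AddCommGrpCat.isZero_of_iff_subsingleton.mpr (hC i (by omega))).eq_zero_of_src _)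
  have hz' : AddCommGrpCat.ofHom ((Ext.mk₀ S.f).postcomp
      (ModuleCat.of R (R ⧸ 𝔪)) (add_zero i)) = 0 := hz
  exact AddCommGrpCat.subsingleton_of_isZero (Limits.IsZero.of_mono_eq_zero _ hz')

theorem exists_isRegular [IsNoetherianRing R] [Module.Finite R A]
    (hlt : 𝔪 • (⊤ : Submodule R A) < ⊤) (hA : ExtVanishesBelow 𝔪 A k) :
    ∃ rs : List R, rs.length = k ∧ (∀ r ∈ rs, r ∈ 𝔪) ∧ IsRegular A rs :=
  ModuleCat.exists_isRegular_of_exists_subsingleton_ext 𝔪 k (ModuleCat.of R A) hlt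
    (ModuleCat.of R (R ⧸ 𝔪))
    (by change Module.support R (R ⧸ 𝔪) = _
        rw [Module.support_eq_zeroLocus, Ideal.annihilator_quotient]) hA

end ExtVanishesBelow

theorem supportDim_add_length_le_of_isRegular {R : Type*} [CommRing R] [IsNoetherianRing R]
    {M : Type*} [AddCommGroup M] [Module R M] [Module.Finite R M] (rs : List R)
    (reg : IsRegular M rs) : (rs.length : WithBot ℕ∞) ≤ Module.supportDim R M := by
  induction rs generalizing M with
  | nil =>
    have : Nontrivial M := reg.nontrivial
    have h := Module.supportDim_ne_bot_of_nontrivial R M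
    generalize Module.supportDim R M = x at *
    cases x with
    | bot => exact absurd rfl h
    | coe x => simp
  | cons x rs ih =>
    rw [isRegular_cons_iff] at reg
    calc ((x :: rs).length : WithBot ℕ∞) = rs.length + 1 := by simp
      _ ≤ Module.supportDim R (QuotSMulTop x M) + 1 := by
        gcongr
        exact ih reg.2
      _ ≤ _ := Module.supportDim_quotSMulTop_succ_le_of_notMem_minimalPrimes
        (fun _ => reg.1.notMem_of_mem_minimalPrimes)

theorem isRegular_length_le {K : Type*} [Field K] {n : ℕ} {M : Type*} [AddCommGroup M]
    [Module (MvPolynomial (Fin n) K) M] [Module.Finite (MvPolynomial (Fin n) K) M]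
    (rs : List (MvPolynomial (Fin n) K)) (reg : IsRegular M rs) : rs.length ≤ n := by
  have h := (supportDim_add_length_le_of_isRegular rs reg).trans
    (Module.supportDim_le_ringKrullDim _ _)
  rw [MvPolynomial.ringKrullDim_of_isNoetherianRing, ringKrullDim_eq_zero_of_field,
    zero_add, Nat.card_fin] at h
  exact_mod_cast h

end ExtDepth

section SquarefreeMonomials

variable {K : Type*} [Field K] {n : ℕ}

theorem sqm_eq_monomial (T : Finset (Fin n)) :
    sqm K T = monomial (∑ i ∈ T, Finsupp.single i 1) 1 := by
  rw [sqm, monomial_sum_one]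
  rfl

theorem sum_single_apply (T : Finset (Fin n)) (i : Fin n) :
    (∑ j ∈ T, Finsupp.single j 1 : Fin n →₀ ℕ) i = if i ∈ T then 1 else 0 := by
  simp [Finsupp.finsetSum_apply, Finsupp.single_apply]

theorem sum_single_le_iff (T : Finset (Fin n)) (m : Fin n →₀ ℕ) :
    (∑ j ∈ T, Finsupp.single j 1 : Fin n →₀ ℕ) ≤ m ↔ T ⊆ m.support := by
  rw [Finsupp.le_def]
  constructor
  · intro h i hi
    have := h i
    rw [sum_single_apply, if_pos hi] at this
    rw [Finsupp.mem_support_iff]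
    omega
  · intro h i
    rw [sum_single_apply]
    split_ifs with hi
    · have := h hi
      rw [Finsupp.mem_support_iff] at this
      omega
    · exact Nat.zero_le _

theorem support_sum_single (T : Finset (Fin n)) :
    (∑ j ∈ T, Finsupp.single j 1 : Fin n →₀ ℕ).support = T := by
  ext i
  rw [Finsupp.mem_support_iff, sum_single_apply]
  simp

theorem mem_span_sqm_image {G : Set (Finset (Fin n))} {p : MvPolynomial (Fin n) K} :
    p ∈ Ideal.span (sqm K '' G) ↔ ∀ m ∈ p.support, ∃ g ∈ G, g ⊆ m.support := by
  have : sqm K '' G = (fun s => monomial s (1 : K)) ''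
      ((fun T : Finset (Fin n) => (∑ j ∈ T, Finsupp.single j 1 : Fin n →₀ ℕ)) '' G) := by
    rw [Set.image_image]
    exact Set.image_congr fun T _ => sqm_eq_monomial T
  rw [this, mem_ideal_span_monomial_image]
  simp only [Set.exists_mem_image, sum_single_le_iff]

theorem sqm_mem_span_iff {G : Set (Finset (Fin n))} {T : Finset (Fin n)} :
    sqm K T ∈ Ideal.span (sqm K '' G) ↔ ∃ g ∈ G, g ⊆ T := by
  classical
  rw [mem_span_sqm_image, sqm_eq_monomial, support_monomial, if_neg one_ne_zero]
  simp [support_sum_single]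

theorem span_sqm_le_iff {G : Set (Finset (Fin n))} {L : Ideal (MvPolynomial (Fin n) K)} :
    Ideal.span (sqm K '' G) ≤ L ↔ ∀ g ∈ G, sqm K g ∈ L := by
  rw [Ideal.span_le, Set.image_subset_iff]
  rfl

theorem sqm_mul_mem_span_iff {G : Set (Finset (Fin n))} {T : Finset (Fin n)}
    {p : MvPolynomial (Fin n) K} :
    p * sqm K T ∈ Ideal.span (sqm K '' G) ↔
      ∀ m ∈ p.support, ∃ g ∈ G, g ⊆ m.support ∪ T := by
  have hs : ∀ m : Fin n →₀ ℕ, (m + ∑ j ∈ T, Finsupp.single j 1).support = m.support ∪ T := by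
    intro m
    rw [Finsupp.support_add_eq_union, support_sum_single]
  rw [mem_span_sqm_image, sqm_eq_monomial]
  constructor
  · intro h m hm
    rw [← hs]
    refine h _ ?_
    rwa [mem_support_iff, coeff_mul_monomial, mul_one, ← mem_support_iff]
  · intro h m hm
    rw [mem_support_iff, coeff_mul_monomial', mul_one] at hm
    split_ifs at hm with hle
    · obtain ⟨g, hg, hgs⟩ := h _ (mem_support_iff.mpr hm)
      rw [← hs, tsub_add_cancel_of_le hle] at hgs
      exact ⟨g, hg, hgs⟩
    · exact absurd rfl hm

end SquarefreeMonomials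

section MonomialDepth

universe u

variable {K : Type u} [Field K] {n : ℕ}

open Pointwise

local notation "𝔪" => (Ideal.span (Set.range X) : Ideal (MvPolynomial (Fin n) K))

theorem extVanishesBelow_quotient_span_X (F : Finset (Fin n)) :
    ExtVanishesBelow 𝔪
      (MvPolynomial (Fin n) K ⧸ Ideal.span ((X : Fin n → MvPolynomial (Fin n) K) '' {i | i ∉ F}))
      F.card := by
  induction F using Finset.induction_on with
  | empty => intro i hi; simp at hi
  | insert v F hv ih =>
    rw [Finset.card_insert_of_notMem hv]
    have hle : Ideal.span ((X : Fin n → MvPolynomial (Fin n) K) '' {i | i ∉ insert v F}) ≤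
        Ideal.span ((X : Fin n → MvPolynomial (Fin n) K) '' {i | i ∉ F}) :=
      Ideal.span_mono (Set.image_mono fun i hi h => hi (Finset.mem_insert_of_mem h))
    refine ExtVanishesBelow.of_smul (x := X v) (Ideal.subset_span ⟨v, rfl⟩)
      (f := Submodule.factor hle) ?_ (Submodule.factor_surjective hle) ?_ ?_ ih
    · rw [isSMulRegular_iff_right_eq_zero_of_smul]
      intro a ha
      obtain ⟨p, rfl⟩ := Ideal.Quotient.mk_surjective a
      change Ideal.Quotient.mk _ (X v * p) = 0 at ha
      rw [Ideal.Quotient.eq_zero_iff_mem, mem_ideal_span_X_image] at ha ⊢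
      intro m hm
      obtain ⟨i, hi, hmi⟩ := ha (m + Finsupp.single v 1) (by
        rw [mem_support_iff, mul_comm, coeff_mul_X]
        exact mem_support_iff.mp hm)
      refine ⟨i, hi, ?_⟩
      have hiv : v ≠ i := by
        rintro rfl
        exact hi (Finset.mem_insert_self _ _)
      simpa [Finsupp.single_apply, hiv] using hmi
    · intro a ha
      obtain ⟨p, rfl⟩ := Ideal.Quotient.mk_surjective a
      have hp : p ∈ Ideal.span ((X : Fin n → MvPolynomial (Fin n) K) '' {i | i ∉ F}) :=
        Ideal.Quotient.eq_zero_iff_mem.mp ha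
      have hset : {i | i ∉ F} = insert v {i | i ∉ insert v F} := by
        ext i
        by_cases h : i = v
        · simp [h, hv]
        · simp [h]
      rw [hset, Set.image_insert_eq, Ideal.mem_span_insert] at hp
      obtain ⟨q, z, hz, rfl⟩ := hp
      refine ⟨Ideal.Quotient.mk _ q, ?_⟩
      change _ = Ideal.Quotient.mk _ (X v * q)
      rw [Ideal.Quotient.eq]
      convert hz using 1
      ring
    · intro b
      obtain ⟨p, rfl⟩ := Ideal.Quotient.mk_surjective b
      change Ideal.Quotient.mk _ (X v * p) = 0
      rw [Ideal.Quotient.eq_zero_iff_mem]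
      exact Ideal.mul_mem_right _ _ (Ideal.subset_span ⟨v, hv, rfl⟩)

theorem extVanishesBelow_quotMod_insert {G : Set (Finset (Fin n))} {T F : Finset (Fin n)}
    (hTF : T ⊆ F) (hins : ∀ i ∉ F, ∃ g ∈ G, g ⊆ insert i T) (hF : ∀ g ∈ G, ¬ g ⊆ F) :
    ExtVanishesBelow 𝔪
      (quotMod (Ideal.span (sqm K '' insert T G)) (Ideal.span (sqm K '' G))) F.card := by
  set A : Ideal (MvPolynomial (Fin n) K) := Ideal.span (sqm K '' insert T G)
  set L : Ideal (MvPolynomial (Fin n) K) := Ideal.span (sqm K '' G)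
  have hTA : sqm K T ∈ A := Ideal.subset_span ⟨T, Set.mem_insert _ _, rfl⟩
  let φ : MvPolynomial (Fin n) K →ₗ[MvPolynomial (Fin n) K] quotMod A L :=
    (Submodule.mkQ _).comp (LinearMap.toSpanSingleton _ A ⟨sqm K T, hTA⟩)
  have hφ : ∀ p, φ p = 0 ↔ p * sqm K T ∈ L := fun p => by
    change Submodule.Quotient.mk _ = 0 ↔ _
    rw [Submodule.Quotient.mk_eq_zero]
    rfl
  have hsurj : Function.Surjective φ := by
    intro y
    obtain ⟨⟨a, ha⟩, rfl⟩ := Submodule.Quotient.mk_surjective _ y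
    have ha' : a ∈ Ideal.span (sqm K '' insert T G) := ha
    rw [Set.image_insert_eq, Ideal.mem_span_insert] at ha'
    obtain ⟨p, z, hz, rfl⟩ := ha'
    refine ⟨p, ?_⟩
    change Submodule.Quotient.mk _ = Submodule.Quotient.mk _
    rw [Submodule.Quotient.eq, Submodule.mem_comap]
    change p * sqm K T - (p * sqm K T + z) ∈ L
    rw [sub_add_cancel_left]
    exact neg_mem hz
  have hker : Ideal.span ((X : Fin n → MvPolynomial (Fin n) K) '' {i | i ∉ F}) =
      LinearMap.ker φ := by
    ext p
    rw [LinearMap.mem_ker, hφ, sqm_mul_mem_span_iff, mem_ideal_span_X_image]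
    refine forall₂_congr fun m _ => ⟨?_, ?_⟩
    · rintro ⟨i, hi, hmi⟩
      obtain ⟨g, hg, hgi⟩ := hins i hi
      refine ⟨g, hg, hgi.trans (Finset.insert_subset ?_ Finset.subset_union_right)⟩
      exact Finset.mem_union_left _ (Finsupp.mem_support_iff.mpr hmi)
    · rintro ⟨g, hg, hgm⟩
      obtain ⟨i, hig, hiF⟩ := Finset.not_subset.mp (hF g hg)
      refine ⟨i, hiF, ?_⟩
      rcases Finset.mem_union.mp (hgm hig) with h | h
      · exact Finsupp.mem_support_iff.mp h
      · exact absurd (hTF h) hiF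
  exact (extVanishesBelow_quotient_span_X F).of_linearEquiv
    ((Submodule.quotEquivOfEq _ _ hker).trans (φ.quotKerEquivOfSurjective hsurj))

theorem extVanishesBelow_quotMod_trans {L A I : Ideal (MvPolynomial (Fin n) K)} {k : ℕ}
    (hLA : L ≤ A) (hAI : A ≤ I) (h₁ : ExtVanishesBelow 𝔪 (quotMod A L) k)
    (h₂ : ExtVanishesBelow 𝔪 (quotMod I A) k) : ExtVanishesBelow 𝔪 (quotMod I L) k := by
  let f : quotMod A L →ₗ[MvPolynomial (Fin n) K] quotMod I L :=
    Submodule.mapQ _ _ (Submodule.inclusion hAI) fun _ h => h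
  have hle : Submodule.comap I.subtype L ≤ Submodule.comap I.subtype A :=
    Submodule.comap_mono hLA
  refine ExtVanishesBelow.extension (f := f) (g := Submodule.factor hle) ?_
    (Submodule.factor_surjective hle) ?_ h₁ h₂
  · rw [injective_iff_map_eq_zero]
    intro a ha
    obtain ⟨p, rfl⟩ := Submodule.Quotient.mk_surjective _ a
    rw [Submodule.Quotient.mk_eq_zero]
    have ha' : (Submodule.Quotient.mk ⟨p.1, hAI p.2⟩ : quotMod I L) = 0 := ha
    have hp := (Submodule.Quotient.mk_eq_zero _).mp ha'
    exact hp
  · intro y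
    obtain ⟨⟨p, hp⟩, rfl⟩ := Submodule.Quotient.mk_surjective _ y
    constructor
    · intro h
      have h' : (Submodule.Quotient.mk ⟨p, hp⟩ : quotMod I A) = 0 := h
      have hpA := (Submodule.Quotient.mk_eq_zero _).mp h'
      exact ⟨Submodule.Quotient.mk ⟨p, hpA⟩, rfl⟩
    · rintro ⟨z, hz⟩
      obtain ⟨⟨q, hq⟩, rfl⟩ := Submodule.Quotient.mk_surjective _ z
      rw [← hz]
      exact (Submodule.Quotient.mk_eq_zero _).mpr hq

theorem extVanishesBelow_quotMod_self {I L : Ideal (MvPolynomial (Fin n) K)} (h : I = L) (k : ℕ) :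
    ExtVanishesBelow 𝔪 (quotMod I L) k := by
  subst h
  have hzero : ∀ x : quotMod I I, x = 0 := by
    intro x
    obtain ⟨p, rfl⟩ := Submodule.Quotient.mk_surjective _ x
    exact (Submodule.Quotient.mk_eq_zero _).mpr p.2
  intro i _
  refine ⟨fun x y => ?_⟩
  have hid : CategoryTheory.CategoryStruct.id
      (ModuleCat.of (MvPolynomial (Fin n) K) (quotMod I I)) = 0 := by
    exact ModuleCat.hom_ext (LinearMap.ext hzero)
  rw [← CategoryTheory.Abelian.Ext.comp_mk₀_id x, ← CategoryTheory.Abelian.Ext.comp_mk₀_id y, hid]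
  simp

theorem extVanishesBelow_quotMod_union {G : Set (Finset (Fin n))} {k : ℕ}
    (𝒰 : Finset (Finset (Fin n))) (hcard : ∀ T ∈ 𝒰, k ≤ T.card)
    (hnot : ∀ T ∈ 𝒰, ∀ g ∈ G, ¬ g ⊆ T)
    (hup : ∀ T ∈ 𝒰, ∀ i ∉ T, insert i T ∈ 𝒰 ∨ ∃ g ∈ G, g ⊆ insert i T) :
    ExtVanishesBelow 𝔪
      (quotMod (Ideal.span (sqm K '' (G ∪ 𝒰))) (Ideal.span (sqm K '' G))) k := by
  induction hN : 𝒰.card generalizing 𝒰 with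
  | zero =>
    rw [Finset.card_eq_zero] at hN
    subst hN
    exact extVanishesBelow_quotMod_self (by simp) k
  | succ N ih =>
    have hne : 𝒰.Nonempty := Finset.card_pos.mp (by omega)
    obtain ⟨T, hT, hmin⟩ := Finset.exists_min_image 𝒰 Finset.card hne
    have ih' := ih (𝒰.erase T) (fun S hS => hcard S (Finset.mem_of_mem_erase hS))
      (fun S hS => hnot S (Finset.mem_of_mem_erase hS))
      (fun S hS i hi => by
        rcases hup S (Finset.mem_of_mem_erase hS) i hi with h | h
        · refine Or.inl (Finset.mem_erase.mpr ⟨?_, h⟩)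
          rintro rfl
          have := hmin S (Finset.mem_of_mem_erase hS)
          rw [Finset.card_insert_of_notMem hi] at this
          omega
        · exact Or.inr h)
      (by rw [Finset.card_erase_of_mem hT]; omega)
    have hset : G ∪ (𝒰 : Set (Finset (Fin n))) = insert T (G ∪ (𝒰.erase T : Finset _)) := by
      rw [← Set.union_insert, ← Finset.coe_insert, Finset.insert_erase hT]
    have hstep : ExtVanishesBelow 𝔪 (quotMod (Ideal.span (sqm K '' (G ∪ 𝒰)))
        (Ideal.span (sqm K '' (G ∪ (𝒰.erase T : Finset _))))) k := by
      rw [hset]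
      intro i hi
      refine extVanishesBelow_quotMod_insert (Finset.Subset.refl T) ?_ ?_ i
        (hi.trans_le (hcard T hT))
      · intro j hj
        rcases hup T hT j hj with h | ⟨g, hg, h⟩
        · refine ⟨_, Or.inr (Finset.mem_erase.mpr ⟨?_, h⟩), Finset.Subset.refl _⟩
          exact fun h' => hj (h' ▸ Finset.mem_insert_self j T)
        · exact ⟨g, Or.inl hg, h⟩
      · rintro g (hg | hg) hgT
        · exact hnot T hT g hg hgT
        · obtain ⟨hne', hg⟩ := Finset.mem_erase.mp hg
          exact hne' (Finset.eq_of_subset_of_card_le hgT (hmin g hg))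
    refine extVanishesBelow_quotMod_trans ?_ ?_ ih' hstep
    · exact Ideal.span_mono (Set.image_mono Set.subset_union_left)
    · rw [hset]
      exact Ideal.span_mono (Set.image_mono (Set.subset_insert _ _))

theorem le_depthIJ_of_extVanishesBelow {I : Ideal (MvPolynomial (Fin n) K)}
    {G : Set (Finset (Fin n))} {T : Finset (Fin n)} (hTI : sqm K T ∈ I)
    (hT : ∀ g ∈ G, ¬ g ⊆ T) {k : ℕ}
    (h : ExtVanishesBelow 𝔪 (quotMod I (Ideal.span (sqm K '' G))) k) :
    k ≤ depthIJ I (Ideal.span (sqm K '' G)) := by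
  have hlt : 𝔪 • (⊤ : Submodule (MvPolynomial (Fin n) K)
      (quotMod I (Ideal.span (sqm K '' G)))) < ⊤ := by
    rw [lt_top_iff_ne_top]
    intro htop
    obtain ⟨r, hr, hr0⟩ := Submodule.exists_sub_one_mem_and_smul_eq_zero_of_fg_of_le_smul 𝔪
      (⊤ : Submodule (MvPolynomial (Fin n) K) (quotMod I (Ideal.span (sqm K '' G))))
      Module.Finite.fg_top htop.ge
    have h0 := hr0 (Submodule.Quotient.mk ⟨sqm K T, hTI⟩) trivial
    rw [← Submodule.Quotient.mk_smul, Submodule.Quotient.mk_eq_zero] at h0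
    have h1 : r * sqm K T ∈ Ideal.span (sqm K '' G) := h0
    rw [sqm_mul_mem_span_iff] at h1
    have hc : coeff 0 (r - 1) = 0 := by
      by_contra hne
      rw [← Set.image_univ, mem_ideal_span_X_image] at hr
      obtain ⟨i, _, hi⟩ := hr 0 (mem_support_iff.mpr hne)
      exact hi rfl
    obtain ⟨g, hg, hgT⟩ := h1 0 (by
      rw [mem_support_iff]
      rw [coeff_sub, coeff_zero_one, sub_eq_zero] at hc
      rw [hc]
      exact one_ne_zero)
    exact hT g hg (by simpa using hgT)
  obtain ⟨rs, hlen, hmem, hreg⟩ := h.exists_isRegular hlt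
  refine le_csSup ⟨n, ?_⟩ ⟨rs, hlen, hmem, hreg⟩
  rintro _ ⟨rs', rfl, _, hreg'⟩
  exact isRegular_length_le rs' hreg'

/-- A depth bound for `I / L` when, away from `L`, the ideal `I` is generated in degrees `> d`
except for two monomials `f₁` and `f₂` of degree `d`. -/
theorem succ_le_depthIJ {d : ℕ} {H G : Set (Finset (Fin n))} {f₁ f₂ b₁ b₂ : Finset (Fin n)}
    (hf₁ : f₁.card = d) (hf₂ : f₂.card = d) (hfH₁ : f₁ ∈ H) (hfH₂ : f₂ ∈ H)
    (hH : ∀ h ∈ H, h ≠ f₁ → h ≠ f₂ → d + 1 ≤ h.card)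
    (hGH : ∀ g ∈ G, ∃ h ∈ H, h ⊆ g)
    (hne : ∃ T, (∃ h ∈ H, h ⊆ T) ∧ ∀ g ∈ G, ¬ g ⊆ T)
    (h₁ : (∀ g ∈ G, ¬ g ⊆ f₁) → f₁ ⊆ b₁ ∧ b₁.card = d + 1 ∧ ∀ g ∈ G, ¬ g ⊆ b₁)
    (h₂ : (∀ g ∈ G, ¬ g ⊆ f₂) → f₂ ⊆ b₂ ∧ b₂.card = d + 1 ∧ (∀ g ∈ G, ¬ g ⊆ b₂) ∧ ¬ f₁ ⊆ b₂) :
    d + 1 ≤ depthIJ (Ideal.span (sqm K '' H)) (Ideal.span (sqm K '' G)) := by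
  classical
  obtain ⟨T, ⟨h, hh, hhT⟩, hT⟩ := hne
  refine le_depthIJ_of_extVanishesBelow (sqm_mem_span_iff.mpr ⟨h, hh, hhT⟩) hT ?_
  set 𝒰 : Finset (Finset (Fin n)) := Finset.univ.filter fun T =>
    d + 1 ≤ T.card ∧ (∃ h ∈ H, h ⊆ T) ∧ (∀ g ∈ G, ¬ g ⊆ T) ∧
      ¬ ((∀ g ∈ G, ¬ g ⊆ f₁) ∧ T = b₁) ∧ ¬ ((∀ g ∈ G, ¬ g ⊆ f₂) ∧ T = b₂) with h𝒰
  have mem𝒰 : ∀ T, T ∈ 𝒰 ↔ d + 1 ≤ T.card ∧ (∃ h ∈ H, h ⊆ T) ∧ (∀ g ∈ G, ¬ g ⊆ T) ∧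
      ¬ ((∀ g ∈ G, ¬ g ⊆ f₁) ∧ T = b₁) ∧ ¬ ((∀ g ∈ G, ¬ g ⊆ f₂) ∧ T = b₂) := fun T => by
    simp [h𝒰]
  have large : ExtVanishesBelow 𝔪
      (quotMod (Ideal.span (sqm K '' (G ∪ 𝒰))) (Ideal.span (sqm K '' G))) (d + 1) := by
    refine extVanishesBelow_quotMod_union 𝒰 (fun S hS => ((mem𝒰 S).mp hS).1)
      (fun S hS => ((mem𝒰 S).mp hS).2.2.1) ?_
    intro S hS i hi
    obtain ⟨hc, ⟨h, hh, hhS⟩, hS1, -, -⟩ := (mem𝒰 S).mp hS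
    by_cases hg : ∃ g ∈ G, g ⊆ insert i S
    · exact Or.inr hg
    · push Not at hg
      have hcard := Finset.card_insert_of_notMem hi
      refine Or.inl ((mem𝒰 _).mpr ⟨by omega, ⟨h, hh, hhS.trans (Finset.subset_insert _ _)⟩, hg,
        ?_, ?_⟩)
      · rintro ⟨hL, hb⟩
        have := (h₁ hL).2.1
        rw [hb] at hcard
        omega
      · rintro ⟨hL, hb⟩
        have := (h₂ hL).2.1
        rw [hb] at hcard
        omega
  have step₁ : ExtVanishesBelow 𝔪 (quotMod (Ideal.span (sqm K '' insert f₁ (G ∪ 𝒰)))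
      (Ideal.span (sqm K '' (G ∪ 𝒰)))) (d + 1) := by
    by_cases hL : ∀ g ∈ G, ¬ g ⊆ f₁
    · obtain ⟨hfb, hbc, hb⟩ := h₁ hL
      rw [← hbc]
      refine extVanishesBelow_quotMod_insert hfb ?_ ?_
      · intro i hi
        by_cases hg : ∃ g ∈ G, g ⊆ insert i f₁
        · obtain ⟨g, hg, hgi⟩ := hg
          exact ⟨g, Or.inl hg, hgi⟩
        · push Not at hg
          have hcard := Finset.card_insert_of_notMem (fun h' => hi (hfb h'))
          refine ⟨_, Or.inr ((mem𝒰 _).mpr ⟨by omega, ⟨f₁, hfH₁, Finset.subset_insert _ _⟩, hg,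
            ?_, ?_⟩), Finset.Subset.refl _⟩
          · rintro ⟨-, hb'⟩
            exact hi (hb' ▸ Finset.mem_insert_self _ _)
          · rintro ⟨hL', hb'⟩
            exact (h₂ hL').2.2.2 (hb' ▸ Finset.subset_insert _ _)
      · rintro g (hg | hg) hgb
        · exact hb g hg hgb
        · obtain ⟨hc, -, -, hgb', -⟩ := (mem𝒰 g).mp hg
          exact hgb' ⟨hL, Finset.eq_of_subset_of_card_le hgb (by omega)⟩
    · push Not at hL
      obtain ⟨g, hg, hgf⟩ := hL
      refine extVanishesBelow_quotMod_self (le_antisymm ?_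
        (Ideal.span_mono (Set.image_mono (Set.subset_insert _ _)))) _
      rw [span_sqm_le_iff]
      rintro S (rfl | hS)
      · exact sqm_mem_span_iff.mpr ⟨g, Or.inl hg, hgf⟩
      · exact Ideal.subset_span ⟨S, hS, rfl⟩
  have step₂ : ExtVanishesBelow 𝔪 (quotMod (Ideal.span (sqm K '' insert f₂ (insert f₁ (G ∪ 𝒰))))
      (Ideal.span (sqm K '' insert f₁ (G ∪ 𝒰)))) (d + 1) := by
    by_cases hL : ∀ g ∈ G, ¬ g ⊆ f₂
    · obtain ⟨hfb, hbc, hb, hfb'⟩ := h₂ hL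
      rw [← hbc]
      refine extVanishesBelow_quotMod_insert hfb ?_ ?_
      · intro i hi
        by_cases hg : ∃ g ∈ G, g ⊆ insert i f₂
        · obtain ⟨g, hg, hgi⟩ := hg
          exact ⟨g, Or.inr (Or.inl hg), hgi⟩
        · push Not at hg
          have hcard := Finset.card_insert_of_notMem (fun h' => hi (hfb h'))
          by_cases hf : f₁ ⊆ insert i f₂
          · exact ⟨f₁, Or.inl rfl, hf⟩
          refine ⟨_, Or.inr (Or.inr ((mem𝒰 _).mpr ⟨by omega, ⟨f₂, hfH₂, Finset.subset_insert _ _⟩,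
            hg, ?_, ?_⟩)), Finset.Subset.refl _⟩
          · rintro ⟨hL', hb'⟩
            exact hf (hb' ▸ (h₁ hL').1)
          · rintro ⟨-, hb'⟩
            exact hi (hb' ▸ Finset.mem_insert_self _ _)
      · rintro g (rfl | hg | hg) hgb
        · exact hfb' hgb
        · exact hb g hg hgb
        · obtain ⟨hc, -, -, -, hgb'⟩ := (mem𝒰 g).mp hg
          exact hgb' ⟨hL, Finset.eq_of_subset_of_card_le hgb (by omega)⟩
    · push Not at hL
      obtain ⟨g, hg, hgf⟩ := hL
      refine extVanishesBelow_quotMod_self (le_antisymm ?_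
        (Ideal.span_mono (Set.image_mono (Set.subset_insert _ _)))) _
      rw [span_sqm_le_iff]
      rintro S (rfl | hS)
      · exact sqm_mem_span_iff.mpr ⟨g, Or.inr (Or.inl hg), hgf⟩
      · exact Ideal.subset_span ⟨S, hS, rfl⟩
  have htop : Ideal.span (sqm K '' insert f₂ (insert f₁ (G ∪ 𝒰))) = Ideal.span (sqm K '' H) := by
    refine le_antisymm ?_ ?_ <;> rw [span_sqm_le_iff]
    · rintro S (rfl | rfl | hS | hS)
      · exact Ideal.subset_span ⟨_, hfH₂, rfl⟩
      · exact Ideal.subset_span ⟨_, hfH₁, rfl⟩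
      · exact sqm_mem_span_iff.mpr (hGH S hS)
      · exact sqm_mem_span_iff.mpr ((mem𝒰 S).mp hS).2.1
    · intro S hS
      rw [sqm_mem_span_iff]
      by_cases hg : ∃ g ∈ G, g ⊆ S
      · obtain ⟨g, hg, hgS⟩ := hg
        exact ⟨g, Or.inr (Or.inr (Or.inl hg)), hgS⟩
      push Not at hg
      by_cases hS₁ : f₁ ⊆ S
      · exact ⟨f₁, Or.inr (Or.inl rfl), hS₁⟩
      by_cases hS₂ : f₂ ⊆ S
      · exact ⟨f₂, Or.inl rfl, hS₂⟩
      refine ⟨S, Or.inr (Or.inr (Or.inr ((mem𝒰 S).mpr ⟨hH S hS ?_ ?_, ⟨S, hS, subset_rfl⟩, hg,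
        ?_, ?_⟩))), subset_rfl⟩
      · rintro rfl
        exact hS₁ subset_rfl
      · rintro rfl
        exact hS₂ subset_rfl
      · rintro ⟨hL, rfl⟩
        exact hS₁ (h₁ hL).1
      · rintro ⟨hL, rfl⟩
        exact hS₂ (h₂ hL).1
  rw [← htop]
  refine extVanishesBelow_quotMod_trans ?_ ?_ large
    (extVanishesBelow_quotMod_trans ?_ ?_ step₁ step₂)
  · exact Ideal.span_mono (Set.image_mono Set.subset_union_left)
  · exact Ideal.span_mono (Set.image_mono
      ((Set.subset_insert _ _).trans (Set.subset_insert _ _)))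
  · exact Ideal.span_mono (Set.image_mono (Set.subset_insert _ _))
  · exact Ideal.span_mono (Set.image_mono (Set.subset_insert _ _))

end MonomialDepth

section Matchings

variable {α γ : Type*} [DecidableEq α] [DecidableEq γ]

/-- The elements of `U` can be assigned distinct neighbours outside `D`. -/
def Matches (N : α → Finset γ) (U : Finset α) (D : Finset γ) : Prop :=
  ∃ φ : α → γ, Set.InjOn φ U ∧ ∀ b ∈ U, φ b ∈ N b ∧ φ b ∉ D

namespace Matches

variable {N : α → Finset γ} {U W R : Finset α} {D D' : Finset γ}

omit [DecidableEq α] in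
theorem card_le (h : Matches N U D) : U.card ≤ (U.biUnion N \ D).card := by
  obtain ⟨φ, hinj, hφ⟩ := h
  refine Finset.card_le_card_of_injOn φ (fun b hb => ?_) hinj
  simp only [Finset.coe_sdiff, Set.mem_sdiff, Finset.mem_coe, Finset.mem_biUnion]
  exact ⟨⟨b, hb, (hφ b hb).1⟩, (hφ b hb).2⟩

theorem of_hall [Nonempty γ] (h : ∀ S ⊆ U, S.Nonempty → S.card ≤ (S.biUnion N \ D).card) :
    Matches N U D := by
  obtain ⟨c₀⟩ := ‹Nonempty γ›
  have hall := (Finset.all_card_le_biUnion_card_iff_exists_injective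
    (fun b : U => N b \ D)).mp fun S => by
      rcases S.eq_empty_or_nonempty with rfl | hS
      · simp
      have := h (S.map (Function.Embedding.subtype _)) (fun x hx => by
        obtain ⟨y, -, rfl⟩ := Finset.mem_map.mp hx
        exact y.2) (hS.map)
      rw [Finset.card_map] at this
      refine this.trans (Finset.card_le_card fun c hc => ?_)
      simp only [Finset.mem_sdiff, Finset.mem_biUnion, Finset.mem_map] at hc ⊢
      obtain ⟨⟨_, ⟨y, hy, rfl⟩, hc⟩, hcD⟩ := hc
      exact ⟨y, hy, hc, hcD⟩
  obtain ⟨f, hf, hfm⟩ := hall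
  refine ⟨fun b => if hb : b ∈ U then f ⟨b, hb⟩ else c₀, ?_, ?_⟩
  · intro x hx y hy hxy
    have hx' : x ∈ U := hx
    have hy' : y ∈ U := hy
    simp only [hx', hy', dite_true] at hxy
    exact congrArg Subtype.val (hf hxy)
  · intro b hb
    simp only [hb, dite_true]
    exact Finset.mem_sdiff.mp (hfm ⟨b, hb⟩)

theorem union (hW : Matches N W D) (hR : Matches N R (W.biUnion N ∪ D)) :
    Matches N (W ∪ R) D := by
  obtain ⟨φ, hφ, hφN⟩ := hW
  obtain ⟨ψ, hψ, hψN⟩ := hR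
  have key : ∀ x ∈ W, ∀ y ∈ R, φ x ≠ ψ y := fun x hx y hy h =>
    (hψN y hy).2 (Finset.mem_union_left _ (Finset.mem_biUnion.mpr ⟨x, hx, h ▸ (hφN x hx).1⟩))
  refine ⟨fun b => if b ∈ W then φ b else ψ b, ?_, ?_⟩
  · intro x hx y hy hxy
    rw [Finset.mem_coe, Finset.mem_union] at hx hy
    by_cases hxW : x ∈ W <;> by_cases hyW : y ∈ W <;> simp only [hxW, hyW, if_true, if_false] at hxy
    · exact hφ hxW hyW hxy
    · exact absurd hxy (key x hxW y (hy.resolve_left hyW))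
    · exact absurd hxy.symm (key y hyW x (hx.resolve_left hxW))
    · exact hψ (hx.resolve_left hxW) (hy.resolve_left hyW) hxy
  · intro b hb
    by_cases hbW : b ∈ W <;> simp only [hbW, if_true, if_false]
    · exact hφN b hbW
    · have := hψN b ((Finset.mem_union.mp hb).resolve_left hbW)
      exact ⟨this.1, fun h => this.2 (Finset.mem_union_right _ h)⟩

omit [DecidableEq α] in
theorem avoid (h : Matches N U D) (h' : ∀ c ∈ D', c ∈ U.biUnion N → c ∈ D) :
    Matches N U D' := by
  obtain ⟨φ, hφ, hφN⟩ := h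
  exact ⟨φ, hφ, fun b hb => ⟨(hφN b hb).1, fun hD => (hφN b hb).2
    (h' _ hD (Finset.mem_biUnion.mpr ⟨b, hb, (hφN b hb).1⟩))⟩⟩

end Matches

/-- A family of points `B` with neighbourhoods `N`, and two distinguished subfamilies `V₁`, `V₂`
such that every neighbour of a point of `Vᵢ` is the neighbour of exactly two points of `Vᵢ`, and is
determined by them; all subfamilies which are not too large admit matchings. -/
structure PairSystem (N : α → Finset γ) (B V₁ V₂ : Finset α) : Prop where
  sub₁ : V₁ ⊆ B
  sub₂ : V₂ ⊆ B
  not_sub₁ : ¬ V₁ ⊆ V₂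
  not_sub₂ : ¬ V₂ ⊆ V₁
  inter : ∀ w ∈ V₁, w ∈ V₂ → ∀ w' ∈ V₁, w' ∈ V₂ → w = w'
  pair₁ : ∀ a ∈ V₁, ∀ c ∈ N a, ∃ b ∈ V₁, b ≠ a ∧ c ∈ N b
  pair₂ : ∀ a ∈ V₂, ∀ c ∈ N a, ∃ b ∈ V₂, b ≠ a ∧ c ∈ N b
  uniq₁ : ∀ a ∈ V₁, ∀ b ∈ V₁, a ≠ b → ∀ c ∈ N a, c ∈ N b → ∀ c' ∈ N a, c' ∈ N b → c = c'
  uniq₂ : ∀ a ∈ V₂, ∀ b ∈ V₂, a ≠ b → ∀ c ∈ N a, c ∈ N b → ∀ c' ∈ N a, c' ∈ N b → c = c'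
  matches₀ : ∀ U ⊆ B, ∀ u ∈ V₁, u ∉ U → ∀ m ∈ V₂, m ∉ U → u ≠ m → Matches N U ∅
  matches₁ : ∀ U ⊆ B, V₁ ⊆ U → ¬ V₂ ⊆ U → ∃ a ∈ V₁, ∃ b ∈ V₁, a ≠ b ∧ ∃ c ∈ N a, c ∈ N b ∧
    Matches N (U \ {a, b}) {c}
  matches₂ : ∀ U ⊆ B, V₂ ⊆ U → ¬ V₁ ⊆ U → ∃ a ∈ V₂, ∃ b ∈ V₂, a ≠ b ∧ ∃ c ∈ N a, c ∈ N b ∧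
    Matches N (U \ {a, b}) {c}
  large : ∀ w ∈ V₁, w ∈ V₂ → 3 ≤ V₁.card ∨ 3 ≤ V₂.card

/-- Disjoint pairs in `V₁` and `V₂` with distinct common neighbours, and a matching of the remaining
points avoiding these two neighbours. -/
def PairSolution (N : α → Finset γ) (B V₁ V₂ : Finset α) : Prop :=
  ∃ a ∈ V₁, ∃ b ∈ V₁, ∃ a' ∈ V₂, ∃ b' ∈ V₂, a ≠ b ∧ a' ≠ b' ∧ a ≠ a' ∧ a ≠ b' ∧ b ≠ a' ∧ b ≠ b' ∧
    ∃ c ∈ N a, c ∈ N b ∧ ∃ c' ∈ N a', c' ∈ N b' ∧ c ≠ c' ∧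
      Matches N (B \ {a, b, a', b'}) {c, c'}

theorem PairSolution.symm {N : α → Finset γ} {B V₁ V₂ : Finset α} (h : PairSolution N B V₁ V₂) :
    PairSolution N B V₂ V₁ := by
  obtain ⟨a, ha, b, hb, a', ha', b', hb', h1, h2, h3, h4, h5, h6, c, hc, hcb, c', hc', hcb', hcc,
    hM⟩ := h
  refine ⟨a', ha', b', hb', a, ha, b, hb, h2, h1, h3.symm, h5.symm, h4.symm, h6.symm, c', hc', hcb',
    c, hc, hcb, hcc.symm, ?_⟩
  convert hM using 1
  · congr 1
    ext x
    simp only [Finset.mem_insert, Finset.mem_singleton]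
    tauto
  · exact Finset.pair_comm _ _

omit [DecidableEq α] in
theorem exists_max_card {p : Finset α → Prop} {B T : Finset α} (hT : p T)
    (hB : ∀ S, p S → S ⊆ B) : ∃ M, p M ∧ T ⊆ M ∧ ∀ S, p S → M ⊆ S → S = M := by
  classical
  obtain ⟨M, hTM, hM⟩ := Set.Finite.exists_le_maximal (s := {S | p S})
    (B.powerset.finite_toSet.subset fun S hS => Finset.mem_powerset.mpr (hB S hS)) hT
  exact ⟨M, hM.prop, hTM, fun S hS hMS => (hM.eq_of_le hS hMS).symm⟩

theorem card_union_biUnion_add_card_inter_le (N : α → Finset γ) (S T : Finset α) :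
    ((S ∪ T).biUnion N).card + ((S ∩ T).biUnion N).card ≤
      (S.biUnion N).card + (T.biUnion N).card := by
  rw [Finset.union_biUnion, ← Finset.card_union_add_card_inter (S.biUnion N)]
  refine Nat.add_le_add_left (Finset.card_le_card fun c hc => ?_) _
  obtain ⟨x, hx, hxc⟩ := Finset.mem_biUnion.mp hc
  rw [Finset.mem_inter] at hx
  exact Finset.mem_inter.mpr ⟨Finset.mem_biUnion.mpr ⟨x, hx.1, hxc⟩,
    Finset.mem_biUnion.mpr ⟨x, hx.2, hxc⟩⟩

omit [DecidableEq α] in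
theorem exists_mem_ne_of_two_le_card {S : Finset α} (h : 2 ≤ S.card) (x : α) :
    ∃ y ∈ S, y ≠ x := Finset.exists_mem_ne (by omega) x

omit [DecidableEq α] in
theorem two_le_card_of_mem {S : Finset α} {a b : α} (ha : a ∈ S) (hb : b ∈ S) (hab : a ≠ b) :
    2 ≤ S.card :=
  Finset.one_lt_card.mpr ⟨a, ha, b, hb, hab⟩

omit [DecidableEq α] [DecidableEq γ] in
theorem Matches.subset {N : α → Finset γ} {U U' : Finset α} {D : Finset γ} (h : Matches N U D)
    (hU : U' ⊆ U) : Matches N U' D := by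
  obtain ⟨φ, hφ, hφN⟩ := h
  exact ⟨φ, hφ.mono (Finset.coe_subset.mpr hU), fun b hb => hφN b (hU hb)⟩

theorem mem_sdiff_union {V W S : Finset α} {x : α} (hV : x ∈ V) (hW : x ∉ W) (hS : x ∉ S) :
    x ∈ V \ (W ∪ S) :=
  Finset.mem_sdiff.mpr ⟨hV, fun hx => (Finset.mem_union.mp hx).elim hW hS⟩

namespace PairSystem

variable {N : α → Finset γ} {B V₁ V₂ : Finset α}

omit [DecidableEq γ] in
theorem symm (h : PairSystem N B V₁ V₂) : PairSystem N B V₂ V₁ where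
  sub₁ := h.sub₂
  sub₂ := h.sub₁
  not_sub₁ := h.not_sub₂
  not_sub₂ := h.not_sub₁
  inter w h1 h2 w' h1' h2' := h.inter w h2 h1 w' h2' h1'
  pair₁ := h.pair₂
  pair₂ := h.pair₁
  uniq₁ := h.uniq₂
  uniq₂ := h.uniq₁
  matches₀ U hU u hu huU m hm hmU hum := h.matches₀ U hU m hm hmU u hu huU hum.symm
  matches₁ := h.matches₂
  matches₂ := h.matches₁
  large w h1 h2 := (h.large w h2 h1).symm

variable (h : PairSystem N B V₁ V₂)
include h

theorem card_le {U : Finset α} (hU : U ⊆ B) {u m : α} (hu : u ∈ V₁) (huU : u ∉ U) (hm : m ∈ V₂)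
    (hmU : m ∉ U) (hum : u ≠ m) : U.card ≤ (U.biUnion N).card := by
  simpa using (h.matches₀ U hU u hu huU m hm hmU hum).card_le

omit [DecidableEq γ] in
theorem exists_mem_sdiff : ∃ x ∈ V₁, x ∉ V₂ := Finset.not_subset.mp h.not_sub₁

theorem card_le_add_one {U : Finset α} (hU : U ⊆ B) (hV : ¬ V₂ ⊆ U) :
    U.card ≤ (U.biUnion N).card + 1 := by
  obtain ⟨x, hx, hx'⟩ := h.exists_mem_sdiff
  obtain ⟨m, hm, hm'⟩ := Finset.not_subset.mp hV
  have := h.card_le ((Finset.erase_subset x U).trans hU) hx (Finset.notMem_erase _ _) hm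
    (fun h' => hm' (Finset.mem_of_mem_erase h')) (by rintro rfl; exact hx' hm)
  have h1 := Finset.pred_card_le_card_erase (s := U) (a := x)
  have h2 := Finset.card_le_card (Finset.biUnion_subset_biUnion_of_subset_left N
    (Finset.erase_subset x U))
  omega

theorem card_le_add_two {U : Finset α} (hU : U ⊆ B) : U.card ≤ (U.biUnion N).card + 2 := by
  by_cases hV : V₂ ⊆ U
  · obtain ⟨m, hm, hm'⟩ := h.symm.exists_mem_sdiff
    have := h.card_le_add_one ((Finset.erase_subset m U).trans hU)
      (fun h' => Finset.notMem_erase m U (h' hm))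
    have h1 := Finset.pred_card_le_card_erase (s := U) (a := m)
    have h2 := Finset.card_le_card (Finset.biUnion_subset_biUnion_of_subset_left N
      (Finset.erase_subset m U))
    omega
  · have := h.card_le_add_one hU hV
    omega

omit [DecidableEq γ] in
theorem two_le_card : 2 ≤ V₁.card := by
  obtain ⟨a, ha, b, hb, hab, -⟩ := h.matches₁ V₁ h.sub₁ subset_rfl h.not_sub₂
  exact two_le_card_of_mem ha hb hab

/-- A subset containing `V₁`, missing two points of `V₂` and violating the marriage condition
yields a solution. -/
theorem solution_of_card_lt [Nonempty γ] {W₀ : Finset α} (hW₀B : W₀ ⊆ B) (hVW₀ : V₁ ⊆ W₀)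
    (hW₀2 : 2 ≤ (V₂ \ W₀).card) (hW₀lt : (W₀.biUnion N).card < W₀.card) :
    PairSolution N B V₁ V₂ := by
  obtain ⟨W, ⟨hWB, hVW, hW2, hWlt⟩, -, hmax⟩ := exists_max_card (B := B)
    (p := fun W => W ⊆ B ∧ V₁ ⊆ W ∧ 2 ≤ (V₂ \ W).card ∧ (W.biUnion N).card < W.card)
    ⟨hW₀B, hVW₀, hW₀2, hW₀lt⟩ fun S hS => hS.1
  obtain ⟨a', ha'V, ha'W, c', hc'a', hc'W⟩ : ∃ a' ∈ V₂, a' ∉ W ∧ ∃ c' ∈ N a', c' ∉ W.biUnion N := by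
    by_contra! hno
    have h2 := h.card_le_add_two (Finset.union_subset hWB h.sub₂)
    have hN : (W ∪ V₂).biUnion N ⊆ W.biUnion N := by
      rw [Finset.biUnion_subset]
      intro x hx c hc
      by_cases hxW : x ∈ W
      · exact Finset.mem_biUnion.mpr ⟨x, hxW, hc⟩
      · exact hno x ((Finset.mem_union.mp hx).resolve_left hxW) hxW c hc
    have h3 := Finset.card_le_card hN
    have h4 := Finset.card_sdiff_add_card V₂ W
    rw [Finset.union_comm] at h4
    omega
  have hW' : ∀ x, c' ∈ N x → x ∉ W := fun x hx hxW => hc'W (Finset.mem_biUnion.mpr ⟨x, hxW, hx⟩)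
  obtain ⟨b', hb'V, hba', hc'b'⟩ := h.pair₂ a' ha'V c' hc'a'
  have hb'W := hW' b' hc'b'
  obtain ⟨a, haV, b, hbV, hab, c, hca, hcb, hM⟩ := h.matches₁ W hWB hVW fun h' => ha'W (h' ha'V)
  have hcW : c ∈ W.biUnion N := Finset.mem_biUnion.mpr ⟨a, hVW haV, hca⟩
  have hne : ∀ x ∈ V₁, ∀ y, y ∉ W → x ≠ y := fun x hx y hy hxy => hy (hxy ▸ hVW hx)
  have hR : Matches N (B \ (W ∪ {a', b'})) (W.biUnion N ∪ {c'}) := by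
    refine Matches.of_hall fun S hS hSne => ?_
    have hSW : Disjoint W S := Finset.disjoint_left.mpr fun x hxW hxS =>
      (Finset.mem_sdiff.mp (hS hxS)).2 (Finset.mem_union_left _ hxW)
    have hS' : ∀ x ∈ S, x ≠ a' ∧ x ≠ b' := fun x hx => by
      have := (Finset.mem_sdiff.mp (hS hx)).2
      simp only [Finset.mem_union, Finset.mem_insert, Finset.mem_singleton, not_or] at this
      exact this.2
    have hle : (W ∪ S).card ≤ ((W ∪ S).biUnion N).card := by
      by_contra! hlt
      have heq := hmax (W ∪ S) ⟨Finset.union_subset hWB (hS.trans Finset.sdiff_subset),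
        hVW.trans Finset.subset_union_left, two_le_card_of_mem (a := a') (b := b')
          (mem_sdiff_union ha'V ha'W fun hx => (hS' a' hx).1 rfl)
          (mem_sdiff_union hb'V hb'W fun hx => (hS' b' hx).2 rfl) hba'.symm, hlt⟩
          Finset.subset_union_left
      obtain ⟨x, hx⟩ := hSne
      exact Finset.disjoint_left.mp hSW (heq ▸ Finset.mem_union_right W hx) hx
    have hN : (W ∪ S).biUnion N ⊆ (W.biUnion N ∪ {c'}) ∪
        (S.biUnion N \ (W.biUnion N ∪ {c'})) := by
      rw [Finset.union_sdiff_self_eq_union, Finset.union_biUnion]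
      exact Finset.union_subset_union_left Finset.subset_union_left
    have h1 := (Finset.card_le_card hN).trans (Finset.card_union_le _ _)
    have h2 := Finset.card_union_le (W.biUnion N) {c'}
    rw [Finset.card_union_of_disjoint hSW] at hle
    rw [Finset.card_singleton] at h2
    omega
  refine ⟨a, haV, b, hbV, a', ha'V, b', hb'V, hab, hba'.symm, hne a haV a' ha'W, hne a haV b' hb'W,
    hne b hbV a' ha'W, hne b hbV b' hb'W, c, hca, hcb, c', hc'a', hc'b',
    fun hcc => hc'W (hcc ▸ hcW), ?_⟩
  have hsub : (W \ {a, b}).biUnion N ⊆ W.biUnion N :=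
    Finset.biUnion_subset_biUnion_of_subset_left N Finset.sdiff_subset
  have hcomb : Matches N (W \ {a, b} ∪ B \ (W ∪ {a', b'})) {c, c'} := by
    refine Matches.union (hM.avoid fun x hx hxN => ?_) (hR.avoid fun x hx _ => ?_)
    · rcases Finset.mem_insert.mp hx with rfl | hx
      · exact Finset.mem_singleton_self _
      · rw [Finset.mem_singleton] at hx
        exact absurd (hsub hxN) (hx ▸ hc'W)
    · rcases Finset.mem_union.mp hx with hx | hx
      · exact Finset.mem_union_left _ (hsub hx)
      · rcases Finset.mem_insert.mp hx with rfl | hx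
        · exact Finset.mem_union_left _ hcW
        · exact Finset.mem_union_right _ hx
  refine hcomb.subset fun x hx => ?_
  simp only [Finset.mem_sdiff, Finset.mem_insert, Finset.mem_singleton, not_or] at hx
  by_cases hxW : x ∈ W <;> simp [hx, hxW]

theorem card_le_of_two_le_sdiff₂ [Nonempty γ] (hno : ¬ PairSolution N B V₁ V₂) {U : Finset α}
    (hU : U ⊆ B) (h2 : 2 ≤ (V₂ \ U).card) : U.card ≤ (U.biUnion N).card := by
  by_cases hV : V₁ ⊆ U
  · by_contra! hlt
    exact hno (h.solution_of_card_lt hU hV h2 hlt)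
  · obtain ⟨u, hu, huU⟩ := Finset.not_subset.mp hV
    obtain ⟨m, hm, hmu⟩ := exists_mem_ne_of_two_le_card h2 u
    rw [Finset.mem_sdiff] at hm
    exact h.card_le hU hu huU hm.1 hm.2 hmu.symm

theorem card_le_of_two_le_sdiff₁ [Nonempty γ] (hno : ¬ PairSolution N B V₁ V₂) {U : Finset α}
    (hU : U ⊆ B) (h2 : 2 ≤ (V₁ \ U).card) : U.card ≤ (U.biUnion N).card :=
  h.symm.card_le_of_two_le_sdiff₂ (fun h' => hno h'.symm) hU h2

omit h in
/-- Two tight sets have a tight union. -/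
theorem card_union_eq {S T : Finset α}
    (hS : S.card = (S.biUnion N).card) (hT : T.card = (T.biUnion N).card)
    (hinter : (S ∩ T).card ≤ ((S ∩ T).biUnion N).card)
    (hunion : (S ∪ T).card ≤ ((S ∪ T).biUnion N).card) :
    (S ∪ T).card = ((S ∪ T).biUnion N).card := by
  have h1 := card_union_biUnion_add_card_inter_le N S T
  have h2 := Finset.card_union_add_card_inter S T
  omega

omit h in
/-- The main criterion: a pair of `V₁` with a common neighbour `c` that is not reached by the
relevant tight sets extends to a solution. -/
theorem solution_of_pair [Nonempty γ] (h : PairSystem N B V₁ V₂) {a b : α} {c : γ}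
    (haV : a ∈ V₁) (hbV : b ∈ V₁) (hab : a ≠ b) (haV₂ : a ∉ V₂) (hbV₂ : b ∉ V₂)
    (hca : c ∈ N a) (hcb : c ∈ N b) {T₀ : Finset α} (hT₀B : T₀ ⊆ B)
    (hT₀ : T₀.card = (T₀.biUnion N).card) (haT₀ : a ∉ T₀) (hbT₀ : b ∉ T₀)
    (hT₀2 : 2 ≤ (V₂ \ T₀).card) (hcT₀ : c ∉ T₀.biUnion N)
    (htight : ∀ S ⊆ B, T₀ ⊆ S → S.card = (S.biUnion N).card → a ∉ S → b ∉ S →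
      2 ≤ (V₂ \ S).card → c ∉ S.biUnion N) :
    PairSolution N B V₁ V₂ := by
  by_contra hno
  have hcard : ∀ S ⊆ B, a ∉ S → b ∉ S → S.card ≤ (S.biUnion N).card := fun S hS ha hb =>
    h.card_le_of_two_le_sdiff₁ hno hS (two_le_card_of_mem (Finset.mem_sdiff.mpr ⟨haV, ha⟩)
      (Finset.mem_sdiff.mpr ⟨hbV, hb⟩) hab)
  have hcardc : ∀ S ⊆ B, T₀ ⊆ S → a ∉ S → b ∉ S → 2 ≤ (V₂ \ S).card →
      S.card ≤ (S.biUnion N \ {c}).card := by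
    intro S hS hTS ha hb h2
    have hle := hcard S hS ha hb
    by_cases hc : c ∈ S.biUnion N
    · rw [Finset.sdiff_singleton_eq_erase, Finset.card_erase_of_mem hc]
      have : S.card ≠ (S.biUnion N).card := fun heq => htight S hS hTS heq ha hb h2 hc
      omega
    · rwa [Finset.sdiff_singleton_eq_erase, Finset.erase_eq_of_notMem hc]
  obtain ⟨M, ⟨hMB, hMa, hMb, hM2, hMc⟩, hTM, hmax⟩ := exists_max_card (B := B) (T := T₀)
    (p := fun S => S ⊆ B ∧ a ∉ S ∧ b ∉ S ∧ 2 ≤ (V₂ \ S).card ∧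
      S.card = (S.biUnion N \ {c}).card)
    ⟨hT₀B, haT₀, hbT₀, hT₀2, by
      rwa [Finset.sdiff_singleton_eq_erase, Finset.erase_eq_of_notMem hcT₀]⟩ fun S hS => hS.1
  obtain ⟨a', ha'V, ha'M, c', hc'a', hc'M, hcc'⟩ : ∃ a' ∈ V₂, a' ∉ M ∧
      ∃ c' ∈ N a', c' ∉ M.biUnion N ∧ c ≠ c' := by
    by_contra! hno'
    have hU := hcard (M ∪ V₂) (Finset.union_subset hMB h.sub₂) (by simp [hMa, haV₂])
      (by simp [hMb, hbV₂])
    have hN : (M ∪ V₂).biUnion N ⊆ (M.biUnion N \ {c}) ∪ {c} := by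
      rw [Finset.biUnion_subset]
      intro x hx y hy
      rw [Finset.sdiff_union_self_eq_union, Finset.mem_union, Finset.mem_singleton]
      by_cases hxM : x ∈ M
      · exact Or.inl (Finset.mem_biUnion.mpr ⟨x, hxM, hy⟩)
      · by_cases hyM : y ∈ M.biUnion N
        · exact Or.inl hyM
        · exact Or.inr (hno' x ((Finset.mem_union.mp hx).resolve_left hxM) hxM y hy hyM).symm
    have h1 := (Finset.card_le_card hN).trans (Finset.card_union_le _ _)
    have h2 := Finset.card_sdiff_add_card V₂ M
    rw [Finset.union_comm] at h2
    rw [Finset.card_singleton] at h1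
    omega
  have hM' : ∀ x, c' ∈ N x → x ∉ M := fun x hx hxM => hc'M (Finset.mem_biUnion.mpr ⟨x, hxM, hx⟩)
  obtain ⟨b', hb'V, hba', hc'b'⟩ := h.pair₂ a' ha'V c' hc'a'
  have hb'M := hM' b' hc'b'
  have hne : ∀ x, x ∉ V₂ → ∀ y ∈ V₂, x ≠ y := fun x hx y hy hxy => hx (hxy ▸ hy)
  have hmatchM : Matches N M {c} := by
    refine Matches.of_hall fun S hS _ => ?_
    have hSB := hS.trans hMB
    have hle := hcard S hSB (fun h' => hMa (hS h')) (fun h' => hMb (hS h'))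
    by_cases hc : c ∈ S.biUnion N
    · rw [Finset.sdiff_singleton_eq_erase, Finset.card_erase_of_mem hc]
      have hne' : S.card ≠ (S.biUnion N).card := fun heq => by
        have hUM : S ∪ T₀ ⊆ M := Finset.union_subset hS hTM
        have hUa : a ∉ S ∪ T₀ := fun h' => hMa (hUM h')
        have hUb : b ∉ S ∪ T₀ := fun h' => hMb (hUM h')
        refine htight (S ∪ T₀) (hUM.trans hMB) Finset.subset_union_right
          (card_union_eq heq hT₀ (hcard _ (Finset.inter_subset_left.trans hSB) ?_ ?_)
            (hcard _ (hUM.trans hMB) hUa hUb)) hUa hUb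
          (hM2.trans (Finset.card_le_card (Finset.sdiff_subset_sdiff subset_rfl hUM)))
          (Finset.biUnion_subset_biUnion_of_subset_left N Finset.subset_union_left hc)
        · exact fun h' => hMa (hS (Finset.mem_inter.mp h').1)
        · exact fun h' => hMb (hS (Finset.mem_inter.mp h').1)
      omega
    · rwa [Finset.sdiff_singleton_eq_erase, Finset.erase_eq_of_notMem hc]
  have hmatchR : Matches N (B \ (M ∪ {a, b, a', b'})) (M.biUnion N ∪ {c, c'}) := by
    refine Matches.of_hall fun S hS hSne => ?_
    have hS' : ∀ x ∈ S, x ∉ M ∧ x ≠ a ∧ x ≠ b ∧ x ≠ a' ∧ x ≠ b' := fun x hx => by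
      have := (Finset.mem_sdiff.mp (hS hx)).2
      simpa only [Finset.mem_union, Finset.mem_insert, Finset.mem_singleton, not_or] using this
    have hMS : Disjoint M S := Finset.disjoint_left.mpr fun x hxM hxS => (hS' x hxS).1 hxM
    have hUB : M ∪ S ⊆ B := Finset.union_subset hMB (hS.trans Finset.sdiff_subset)
    have hUa : a ∉ M ∪ S := by
      rw [Finset.mem_union, not_or]
      exact ⟨hMa, fun hx => (hS' a hx).2.1 rfl⟩
    have hUb : b ∉ M ∪ S := by
      rw [Finset.mem_union, not_or]
      exact ⟨hMb, fun hx => (hS' b hx).2.2.1 rfl⟩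
    have hU2 : 2 ≤ (V₂ \ (M ∪ S)).card := two_le_card_of_mem
      (mem_sdiff_union ha'V ha'M fun hx => (hS' a' hx).2.2.2.1 rfl)
      (mem_sdiff_union hb'V hb'M fun hx => (hS' b' hx).2.2.2.2 rfl) hba'.symm
    have hle := hcardc (M ∪ S) hUB (hTM.trans Finset.subset_union_left) hUa hUb hU2
    have hlt : (M ∪ S).card ≠ ((M ∪ S).biUnion N \ {c}).card := fun heq => by
      have heq' := hmax (M ∪ S) ⟨hUB, hUa, hUb, hU2, heq⟩ Finset.subset_union_left
      obtain ⟨x, hx⟩ := hSne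
      exact (hS' x hx).1 (heq' ▸ Finset.mem_union_right M hx)
    have hN : (M ∪ S).biUnion N \ {c} ⊆ ((M.biUnion N \ {c}) ∪ {c'}) ∪
        (S.biUnion N \ (M.biUnion N ∪ {c, c'})) := by
      intro y hy
      simp only [Finset.mem_sdiff, Finset.mem_union, Finset.mem_insert, Finset.mem_singleton,
        Finset.union_biUnion] at hy ⊢
      tauto
    have h1 := (Finset.card_le_card hN).trans (Finset.card_union_le _ _)
    have h2 := Finset.card_union_le (M.biUnion N \ {c}) {c'}
    rw [Finset.card_union_of_disjoint hMS] at hle hlt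
    rw [Finset.card_singleton] at h2
    omega
  refine hno ⟨a, haV, b, hbV, a', ha'V, b', hb'V, hab, hba'.symm, hne a haV₂ a' ha'V,
    hne a haV₂ b' hb'V, hne b hbV₂ a' ha'V, hne b hbV₂ b' hb'V, c, hca, hcb, c', hc'a', hc'b',
    hcc', ?_⟩
  refine ((hmatchM.avoid fun x hx hxN => ?_).union hmatchR).subset fun x hx => ?_
  · rcases Finset.mem_insert.mp hx with rfl | hx
    · exact Finset.mem_singleton_self _
    · rw [Finset.mem_singleton] at hx
      exact absurd hxN (hx ▸ hc'M)
  · simp only [Finset.mem_sdiff, Finset.mem_insert, Finset.mem_singleton, not_or] at hx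
    by_cases hxM : x ∈ M <;> simp [hx, hxM]

omit h in
/-- The criterion applies if some tight set contains `V₁ ∩ V₂` and misses two points of `V₁` and two
points of `V₂`. -/
theorem solution_of_tight [Nonempty γ] (h : PairSystem N B V₁ V₂) {T : Finset α} (hTB : T ⊆ B)
    (hT : T.card = (T.biUnion N).card) (hT1 : 2 ≤ (V₁ \ T).card) (hT2 : 2 ≤ (V₂ \ T).card)
    (hVT : V₁ ∩ V₂ ⊆ T) : PairSolution N B V₁ V₂ := by
  by_contra hno
  obtain ⟨T₀, ⟨hB, hT₀, h1, h2⟩, hTT₀, hmax⟩ := exists_max_card (B := B) (T := T)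
    (p := fun S => S ⊆ B ∧ S.card = (S.biUnion N).card ∧ 2 ≤ (V₁ \ S).card ∧ 2 ≤ (V₂ \ S).card)
    ⟨hTB, hT, hT1, hT2⟩ fun S hS => hS.1
  have hV : ∀ x ∈ V₁, x ∉ T₀ → x ∉ V₂ := fun x hx hxT hx2 =>
    hxT (hTT₀ (hVT (Finset.mem_inter.mpr ⟨hx, hx2⟩)))
  obtain ⟨a, haV, haT, c, hca, hcT⟩ : ∃ a ∈ V₁, a ∉ T₀ ∧ ∃ c ∈ N a, c ∉ T₀.biUnion N := by
    by_contra! hno'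
    have hsub : V₂ \ T₀ ⊆ V₂ \ (T₀ ∪ V₁) := fun x hx => by
      obtain ⟨hx2, hxT⟩ := Finset.mem_sdiff.mp hx
      exact mem_sdiff_union hx2 hxT fun hx1 => hV x hx1 hxT hx2
    have hle := h.card_le_of_two_le_sdiff₂ hno (Finset.union_subset hB h.sub₁)
      (h2.trans (Finset.card_le_card hsub))
    have hN : (T₀ ∪ V₁).biUnion N ⊆ T₀.biUnion N := by
      rw [Finset.biUnion_subset]
      intro x hx c hc
      by_cases hxW : x ∈ T₀
      · exact Finset.mem_biUnion.mpr ⟨x, hxW, hc⟩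
      · exact hno' x ((Finset.mem_union.mp hx).resolve_left hxW) hxW c hc
    have h3 := Finset.card_le_card hN
    have h4 := Finset.card_sdiff_add_card V₁ T₀
    rw [Finset.union_comm] at h4
    omega
  obtain ⟨b, hbV, hba, hcb⟩ := h.pair₁ a haV c hca
  have hbT : b ∉ T₀ := fun hx => hcT (Finset.mem_biUnion.mpr ⟨b, hx, hcb⟩)
  refine hno (h.solution_of_pair haV hbV hba.symm (hV a haV haT) (hV b hbV hbT) hca hcb hB hT₀ haT
    hbT h2 hcT fun S hSB hTS hS haS hbS hS2 => ?_)
  rwa [hmax S ⟨hSB, hS, two_le_card_of_mem (Finset.mem_sdiff.mpr ⟨haV, haS⟩)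
    (Finset.mem_sdiff.mpr ⟨hbV, hbS⟩) hba.symm, hS2⟩ hTS]

omit h in
theorem solution_of_three_le_card [Nonempty γ] (h : PairSystem N B V₁ V₂) {w : α} (hw₁ : w ∈ V₁)
    (hw₂ : w ∈ V₂) (hcard : 3 ≤ V₁.card) : PairSolution N B V₁ V₂ := by
  by_contra hno
  have : Nonempty α := ⟨w⟩
  have hinter : V₁ ∩ V₂ ⊆ {w} := fun x hx => by
    rw [Finset.mem_inter] at hx
    exact Finset.mem_singleton.mpr (h.inter x hx.1 hx.2 w hw₁ hw₂)
  have hV₂ : ∀ x ∈ V₁, x ≠ w → x ∉ V₂ := fun x hx hxw hx2 => hxw (h.inter x hx hx2 w hw₁ hw₂)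
  have hmem : ∀ S : Finset α, ∀ x ∈ (V₁ \ {w}) \ S, x ∈ V₁ ∧ x ≠ w ∧ x ∉ S := fun S x hx => by
    simpa [and_assoc] using hx
  have htwo : ∀ S : Finset α, 2 ≤ ((V₁ \ {w}) \ S).card → 2 ≤ (V₁ \ S).card := fun S hS =>
    hS.trans (Finset.card_le_card (Finset.sdiff_subset_sdiff Finset.sdiff_subset subset_rfl))
  obtain ⟨M, ⟨hMB, hM, hwM, hM2⟩, -, hmax⟩ := exists_max_card (B := B) (T := ∅)
    (p := fun S => S ⊆ B ∧ S.card = (S.biUnion N).card ∧ w ∉ S ∧ 2 ≤ ((V₁ \ {w}) \ S).card)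
    ⟨by simp, by simp, by simp, by
      rw [Finset.sdiff_empty, Finset.card_sdiff_of_subset (by simpa using hw₁),
        Finset.card_singleton]
      omega⟩ fun S hS => hS.1
  have hfull : ∀ a ∈ V₁, ∀ b ∈ V₁, a ≠ w → b ≠ w → a ≠ b → ∀ c ∈ N a, c ∈ N b →
      c ∈ M.biUnion N := by
    intro a ha b hb haw hbw hab c hca hcb
    by_contra hcM
    have haM : a ∉ M := fun hx => hcM (Finset.mem_biUnion.mpr ⟨a, hx, hca⟩)
    have hbM : b ∉ M := fun hx => hcM (Finset.mem_biUnion.mpr ⟨b, hx, hcb⟩)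
    obtain ⟨S, hSB, hS, haS, hbS, hS2, hcS⟩ : ∃ S ⊆ B, S.card = (S.biUnion N).card ∧ a ∉ S ∧ b ∉ S ∧
        2 ≤ (V₂ \ S).card ∧ c ∈ S.biUnion N := by
      by_contra! hno'
      exact hno (h.solution_of_pair ha hb hab (hV₂ a ha haw) (hV₂ b hb hbw) hca hcb
        (T₀ := ∅) (by simp) (by simp) (by simp) (by simp) (by simpa using h.symm.two_le_card)
        (by simp) fun S hSB _ hS haS hbS hS2 => hno' S hSB hS haS hbS hS2)
    have hwS : w ∉ S := fun hwS => hno (h.solution_of_tight hSB hS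
      (two_le_card_of_mem (Finset.mem_sdiff.mpr ⟨ha, haS⟩) (Finset.mem_sdiff.mpr ⟨hb, hbS⟩) hab)
      hS2 (hinter.trans (by simpa using hwS)))
    have hU2 : 2 ≤ ((V₁ \ {w}) \ (M ∪ S)).card := two_le_card_of_mem
      (mem_sdiff_union (by simp [ha, haw]) haM haS)
      (mem_sdiff_union (by simp [hb, hbw]) hbM hbS) hab
    have hUB := Finset.union_subset hMB hSB
    have hU := card_union_eq hM hS
      (h.card_le_of_two_le_sdiff₁ hno (Finset.inter_subset_left.trans hMB)
        ((htwo M hM2).trans (Finset.card_le_card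
          (Finset.sdiff_subset_sdiff subset_rfl Finset.inter_subset_left))))
      (h.card_le_of_two_le_sdiff₁ hno hUB (htwo _ hU2))
    have heq := hmax (M ∪ S) ⟨hUB, hU, by simp [hwM, hwS], hU2⟩ Finset.subset_union_left
    exact hcM (heq ▸ Finset.biUnion_subset_biUnion_of_subset_left N Finset.subset_union_right hcS)
  have hUB : M ∪ V₁ ⊆ B := Finset.union_subset hMB h.sub₁
  have hwc : ∀ c ∈ (M ∪ V₁).biUnion N \ M.biUnion N, c ∈ N w := by
    intro c hc
    obtain ⟨hc, hcM⟩ := Finset.mem_sdiff.mp hc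
    obtain ⟨x, hx, hcx⟩ := Finset.mem_biUnion.mp hc
    have hxV := (Finset.mem_union.mp hx).resolve_left
      fun hxM => hcM (Finset.mem_biUnion.mpr ⟨x, hxM, hcx⟩)
    by_contra hcw
    obtain ⟨y, hyV, hyx, hcy⟩ := h.pair₁ x hxV c hcx
    exact hcM (hfull x hxV y hyV (fun h' => hcw (h' ▸ hcx)) (fun h' => hcw (h' ▸ hcy)) hyx.symm c
      hcx hcy)
  have hpartner : ∀ c ∈ (M ∪ V₁).biUnion N \ M.biUnion N,
      ∃ z ∈ V₂ \ (M ∪ V₁), c ∈ N z := by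
    intro c hc
    have hcw := hwc c hc
    obtain ⟨z, hzV, hzw, hcz⟩ := h.pair₂ w hw₂ c hcw
    refine ⟨z, mem_sdiff_union hzV ?_ fun hz1 => hzw (h.inter z hz1 hzV w hw₁ hw₂), hcz⟩
    exact fun hzM => (Finset.mem_sdiff.mp hc).2 (Finset.mem_biUnion.mpr ⟨z, hzM, hcz⟩)
  have hX : ((M ∪ V₁).biUnion N \ M.biUnion N).card ≤ (V₂ \ (M ∪ V₁)).card := by
    choose! p hp hcp using hpartner
    refine Finset.card_le_card_of_injOn p hp fun c hc c' hc' hcc' => ?_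
    have hpc := Finset.mem_sdiff.mp (hp c hc)
    refine h.uniq₂ w hw₂ (p c) hpc.1 ?_ c (hwc c hc) (hcp c hc) c' (hwc c' hc')
      (hcc' ▸ hcp c' hc')
    exact fun h' => hpc.2 (h' ▸ Finset.mem_union_right _ hw₁)
  have hX' : ((M ∪ V₁).biUnion N \ M.biUnion N).card + 1 ≤ (V₁ \ M).card := by
    have hpartner₁ : ∀ c ∈ (M ∪ V₁).biUnion N \ M.biUnion N,
        ∃ z ∈ (V₁ \ M).erase w, c ∈ N z := by
      intro c hc
      obtain ⟨z, hzV, hzw, hcz⟩ := h.pair₁ w hw₁ c (hwc c hc)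
      refine ⟨z, Finset.mem_erase.mpr ⟨hzw, Finset.mem_sdiff.mpr ⟨hzV, ?_⟩⟩, hcz⟩
      exact fun hzM => (Finset.mem_sdiff.mp hc).2 (Finset.mem_biUnion.mpr ⟨z, hzM, hcz⟩)
    choose! p hp hcp using hpartner₁
    rw [← Finset.card_erase_add_one (Finset.mem_sdiff.mpr ⟨hw₁, hwM⟩)]
    refine Nat.succ_le_succ (Finset.card_le_card_of_injOn p hp fun c hc c' hc' hcc' => ?_)
    have hpc := Finset.mem_erase.mp (hp c hc)
    exact h.uniq₁ w hw₁ (p c) (Finset.mem_sdiff.mp hpc.2).1 hpc.1.symm c (hwc c hc) (hcp c hc) c'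
      (hwc c' hc') (hcc' ▸ hcp c' hc')
  have hV3 : 3 ≤ (V₁ \ M).card := by
    have hw' : w ∈ V₁ \ M := Finset.mem_sdiff.mpr ⟨hw₁, hwM⟩
    rw [← Finset.card_erase_add_one hw']
    refine Nat.succ_le_succ (hM2.trans (Finset.card_le_card fun x hx => ?_))
    obtain ⟨hx1, hx2, hx3⟩ := hmem M x hx
    exact Finset.mem_erase.mpr ⟨hx2, Finset.mem_sdiff.mpr ⟨hx1, hx3⟩⟩
  have h1 := Finset.card_sdiff_add_card V₁ M
  rw [Finset.union_comm] at h1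
  have h2 := Finset.card_sdiff_add_card_eq_card (Finset.biUnion_subset_biUnion_of_subset_left N
    (Finset.subset_union_left (s₁ := M) (s₂ := V₁)))
  have h3 := h.card_le_add_two hUB
  by_cases hc2 : 2 ≤ (V₂ \ (M ∪ V₁)).card
  · have := h.card_le_of_two_le_sdiff₂ hno hUB hc2
    omega
  by_cases hc1 : V₂ ⊆ M ∪ V₁
  · rw [Finset.sdiff_eq_empty_iff_subset.mpr hc1, Finset.card_empty] at hX
    omega
  · have := h.card_le_add_one hUB hc1
    omega

omit h in
theorem solution [Nonempty γ] (h : PairSystem N B V₁ V₂) : PairSolution N B V₁ V₂ := by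
  by_cases hw : ∃ w ∈ V₁, w ∈ V₂
  · obtain ⟨w, hw₁, hw₂⟩ := hw
    rcases h.large w hw₁ hw₂ with h3 | h3
    · exact h.solution_of_three_le_card hw₁ hw₂ h3
    · exact (h.symm.solution_of_three_le_card hw₂ hw₁ h3).symm
  · refine h.solution_of_tight (T := ∅) (by simp) (by simp) (by simpa using h.two_le_card)
      (by simpa using h.symm.two_le_card) fun x hx => ?_
    rw [Finset.mem_inter] at hx
    exact absurd ⟨x, hx⟩ hw

end PairSystem

end Matchings

section IntervalPartitions

variable {K : Type*} [Field K] {n : ℕ}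

theorem sqm_mem_of_subset {L : Ideal (MvPolynomial (Fin n) K)} {S T : Finset (Fin n)} (hST : S ⊆ T)
    (hS : sqm K S ∈ L) : sqm K T ∈ L :=
  L.mem_of_dvd (Finset.prod_dvd_prod_of_subset _ _ _ hST) hS

theorem mem_sqPoset_of_subset {I J : Ideal (MvPolynomial (Fin n) K)} {S T V : Finset (Fin n)}
    (hS : S ∈ sqPoset I J) (hV : V ∈ sqPoset I J) (hST : S ⊆ T) (hTV : T ⊆ V) :
    T ∈ sqPoset I J :=
  ⟨sqm_mem_of_subset hST hS.1, fun h => hV.2 (sqm_mem_of_subset hTV h)⟩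

theorem mem_sqPoset_inf {G : Set (Finset (Fin n))} {J : Ideal (MvPolynomial (Fin n) K)}
    {T : Finset (Fin n)} :
    T ∈ sqPoset (Ideal.span (sqm K '' G)) (J ⊓ Ideal.span (sqm K '' G)) ↔
      (∃ g ∈ G, g ⊆ T) ∧ sqm K T ∉ J := by
  simp only [sqPoset, Set.mem_ofPred_eq, Ideal.mem_inf, ← sqm_mem_span_iff (K := K)]
  tauto

theorem exists_partition_of_le_sdepth {I J : Ideal (MvPolynomial (Fin n) K)} {k : ℕ} (hk : 0 < k)
    (h : k ≤ sdepth I J) : ∃ F, IsIntervalPartition I J F ∧ ∀ p ∈ F, k ≤ p.2.card := by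
  have hbdd : BddAbove {k | ∃ F, IsIntervalPartition I J F ∧ ∀ p ∈ F, k ≤ p.2.card} := by
    by_contra hb
    rw [sdepth, Nat.sSup_of_not_bddAbove hb] at h
    omega
  have hne : {k | ∃ F, IsIntervalPartition I J F ∧ ∀ p ∈ F, k ≤ p.2.card}.Nonempty := by
    by_contra hb
    rw [sdepth, Set.not_nonempty_iff_eq_empty.mp hb, csSup_empty] at h
    exact absurd h (by simp; omega)
  obtain ⟨F, hF, hFk⟩ := Nat.sSup_mem hne hbdd
  exact ⟨F, hF, fun p hp => h.trans (hFk p hp)⟩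

theorem le_sdepth {I J : Ideal (MvPolynomial (Fin n) K)} {k : ℕ} (hne : (sqPoset I J).Nonempty)
    {F : Finset (Finset (Fin n) × Finset (Fin n))} (hF : IsIntervalPartition I J F)
    (hFk : ∀ p ∈ F, k ≤ p.2.card) : k ≤ sdepth I J := by
  refine le_csSup ⟨n, ?_⟩ ⟨F, hF, hFk⟩
  rintro m ⟨F', hF', hm⟩
  obtain ⟨T, hT⟩ := hne
  obtain ⟨p, ⟨hp, -⟩, -⟩ := hF'.2 T hT
  exact (hm p hp).trans ((Finset.card_le_univ _).trans (Fintype.card_fin n).le)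

namespace IsIntervalPartition

variable {I J : Ideal (MvPolynomial (Fin n) K)} {F : Finset (Finset (Fin n) × Finset (Fin n))}

theorem eq_of_mem (hF : IsIntervalPartition I J F) {p q : Finset (Fin n) × Finset (Fin n)}
    (hp : p ∈ F) (hq : q ∈ F) {T : Finset (Fin n)} (hpT : p.1 ⊆ T) (hTp : T ⊆ p.2) (hqT : q.1 ⊆ T)
    (hTq : T ⊆ q.2) : p = q :=
  (hF.2 T (mem_sqPoset_of_subset (hF.1 p hp).1 (hF.1 p hp).2.1 hpT hTp)).unique
    ⟨hp, hpT, hTp⟩ ⟨hq, hqT, hTq⟩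

theorem exists_mem_of_minimal (hF : IsIntervalPartition I J F) {T : Finset (Fin n)}
    (hT : T ∈ sqPoset I J) (hmin : ∀ S ∈ sqPoset I J, S ⊆ T → S = T) :
    ∃ v, (T, v) ∈ F ∧ T ⊆ v := by
  obtain ⟨⟨u, v⟩, ⟨hp, hpT, hTp⟩, -⟩ := hF.2 T hT
  obtain rfl := hmin u (hF.1 _ hp).1 hpT
  exact ⟨v, hp, hTp⟩

theorem exists_pair (hF : IsIntervalPartition I J F) {k : ℕ} {f v : Finset (Fin n)}
    (hp : (f, v) ∈ F) (hfk : f.card = k) (hv : k + 2 ≤ v.card) :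
    ∃ x y, x ∉ f ∧ y ∉ f ∧ x ≠ y ∧ insert x f ⊆ v ∧ insert y f ⊆ v ∧
      insert x f ∈ sqPoset I J ∧ insert y f ∈ sqPoset I J := by
  have hfv := (hF.1 _ hp).2.2
  have hc : 1 < (v \ f).card := by
    have : v.card - f.card = (v \ f).card := (Finset.card_sdiff_of_subset hfv).symm
    omega
  obtain ⟨x, hx, y, hy, hxy⟩ := Finset.one_lt_card.mp hc
  rw [Finset.mem_sdiff] at hx hy
  have hxv := Finset.insert_subset hx.1 hfv
  have hyv := Finset.insert_subset hy.1 hfv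
  exact ⟨x, y, hx.2, hy.2, hxy, hxv, hyv,
    mem_sqPoset_of_subset (hF.1 _ hp).1 (hF.1 _ hp).2.1 (Finset.subset_insert _ _) hxv,
    mem_sqPoset_of_subset (hF.1 _ hp).1 (hF.1 _ hp).2.1 (Finset.subset_insert _ _) hyv⟩

theorem exists_between (hF : IsIntervalPartition I J F) {k : ℕ} (hFk : ∀ p ∈ F, k + 1 ≤ p.2.card)
    {U : Finset (Finset (Fin n))} (hU : ∀ u ∈ U, u.card = k ∧ ∃ v, (u, v) ∈ F) :
    ∃ ψ : Finset (Fin n) → Finset (Fin n), ∀ u ∈ U, ∃ v, (u, v) ∈ F ∧ u ⊆ ψ u ∧ ψ u ⊆ v ∧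
      (ψ u).card = k + 1 ∧ ψ u ∈ sqPoset I J := by
  have : ∀ u, ∃ c, u ∈ U → ∃ v, (u, v) ∈ F ∧ u ⊆ c ∧ c ⊆ v ∧ c.card = k + 1 ∧
      c ∈ sqPoset I J := by
    intro u
    by_cases hu : u ∈ U
    · obtain ⟨huk, v, hp⟩ := hU u hu
      obtain ⟨c, hc, hcv, hck⟩ := Finset.exists_subsuperset_card_eq (hF.1 _ hp).2.2
        (huk ▸ Nat.le_succ _) (hFk _ hp)
      exact ⟨c, fun _ => ⟨v, hp, hc, hcv, hck,
        mem_sqPoset_of_subset (hF.1 _ hp).1 (hF.1 _ hp).2.1 hc hcv⟩⟩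
    · exact ⟨∅, fun h => absurd h hu⟩
  exact Classical.axiomOfChoice this

end IsIntervalPartition

open Classical in
/-- The monomials of degree `k` of `I \ J` which are multiples of `b`. -/
noncomputable def degMultiples (I J : Ideal (MvPolynomial (Fin n) K)) (k : ℕ) (b : Finset (Fin n)) :
    Finset (Finset (Fin n)) :=
  Finset.univ.filter fun c => b ⊆ c ∧ c ∈ degSet I J k

variable {I J : Ideal (MvPolynomial (Fin n) K)} {d : ℕ}

theorem mem_degMultiples {k : ℕ} {b c : Finset (Fin n)} :
    c ∈ degMultiples I J k b ↔ b ⊆ c ∧ c ∈ degSet I J k := by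
  simp [degMultiples]

theorem mem_sqPoset_of_inf {L : Ideal (MvPolynomial (Fin n) K)} (hL : L ≤ I) {T : Finset (Fin n)}
    (hT : T ∈ sqPoset L (J ⊓ L)) : T ∈ sqPoset I J :=
  ⟨hL hT.1, fun h => hT.2 ⟨h, hT.1⟩⟩

theorem span_sqm_le_of_degSet {U : Set (Finset (Fin n))} (hU : U ⊆ sqPoset I J) :
    Ideal.span (sqm K '' U) ≤ I :=
  span_sqm_le_iff.mpr fun _ hg => (hU hg).1

theorem matches_of_le_sdepth {U : Finset (Finset (Fin n))} (hU : ∀ u ∈ U, u ∈ degSet I J (d + 1))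
    (h : d + 2 ≤ sdepth (Ideal.span (sqm K '' (U : Set (Finset (Fin n)))))
      (J ⊓ Ideal.span (sqm K '' (U : Set (Finset (Fin n)))))) :
    Matches (degMultiples I J (d + 2)) U ∅ := by
  obtain ⟨F, hF, hFd⟩ := exists_partition_of_le_sdepth (Nat.succ_pos _) h
  have hle := span_sqm_le_of_degSet (I := I) (J := J) (U := (U : Set (Finset (Fin n))))
    fun u hu => (hU u hu).1
  obtain ⟨ψ, hψ⟩ := hF.exists_between (k := d + 1) hFd (U := U) fun u hu => by
    refine ⟨(hU u hu).2, ?_⟩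
    obtain ⟨v, hv, -⟩ := hF.exists_mem_of_minimal
      (mem_sqPoset_inf.mpr ⟨⟨u, hu, subset_rfl⟩, (hU u hu).1.2⟩) fun S hS hSu => by
        obtain ⟨⟨g, hg, hgS⟩, -⟩ := mem_sqPoset_inf.mp hS
        obtain rfl := Finset.eq_of_subset_of_card_le (hgS.trans hSu)
          ((hU u hu).2.trans (hU g hg).2.symm).le
        exact hSu.antisymm hgS
    exact ⟨v, hv⟩
  refine ⟨ψ, fun u hu u' hu' huu' => ?_, fun u hu => ?_⟩
  · obtain ⟨v, hv, huψ, hψv, -, -⟩ := hψ u hu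
    obtain ⟨v', hv', huψ', hψv', -, -⟩ := hψ u' hu'
    exact congrArg Prod.fst (hF.eq_of_mem hv hv' huψ hψv (huu' ▸ huψ') (huu' ▸ hψv'))
  · obtain ⟨v, -, huψ, -, hcard, hmem⟩ := hψ u hu
    exact ⟨mem_degMultiples.mpr ⟨huψ, mem_sqPoset_of_inf hle hmem, hcard⟩, Finset.notMem_empty _⟩

theorem exists_pair_matches_of_le_sdepth {f : Finset (Fin n)} (hf : f ∈ degSet I J d)
    {U : Finset (Finset (Fin n))} (hU : ∀ u ∈ U, u ∈ degSet I J (d + 1))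
    (h : d + 2 ≤ sdepth (Ideal.span (sqm K '' (insert f (U : Set (Finset (Fin n))))))
      (J ⊓ Ideal.span (sqm K '' (insert f (U : Set (Finset (Fin n))))))) :
    ∃ a ∈ degSet I J (d + 1), f ⊆ a ∧ ∃ b ∈ degSet I J (d + 1), f ⊆ b ∧ a ≠ b ∧
      ∃ c ∈ degMultiples I J (d + 2) a, c ∈ degMultiples I J (d + 2) b ∧
        Matches (degMultiples I J (d + 2)) (U \ {a, b}) {c} := by
  obtain ⟨F, hF, hFd⟩ := exists_partition_of_le_sdepth (Nat.succ_pos _) h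
  have hle := span_sqm_le_of_degSet (I := I) (J := J)
    (U := insert f (U : Set (Finset (Fin n)))) (Set.insert_subset hf.1 fun u hu => (hU u hu).1)
  have hcardG : ∀ g ∈ insert f (U : Set (Finset (Fin n))), g = f ∨ g.card = d + 1 := by
    rintro g (rfl | hg)
    · exact Or.inl rfl
    · exact Or.inr (hU g hg).2
  obtain ⟨v, hv, hfv⟩ := hF.exists_mem_of_minimal
    (mem_sqPoset_inf.mpr ⟨⟨f, Set.mem_insert _ _, subset_rfl⟩, hf.1.2⟩) fun S hS hSf => by
      obtain ⟨⟨g, hg, hgS⟩, -⟩ := mem_sqPoset_inf.mp hS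
      have := Finset.card_le_card (hgS.trans hSf)
      rcases hcardG g hg with rfl | hg
      · exact hSf.antisymm hgS
      · rw [hf.2, hg] at this
        omega
  obtain ⟨x, y, hxf, hyf, hxy, hxv, hyv, hx, hy⟩ := hF.exists_pair hv hf.2 (hFd _ hv)
  have hins : ∀ {z : Fin n} {T : Finset (Fin n)} {k : ℕ}, z ∉ T → T.card = k →
      (insert z T).card = k + 1 := fun hz hT => hT ▸ Finset.card_insert_of_notMem hz
  have hcv : insert x (insert y f) ⊆ v := Finset.insert_subset
    (hxv (Finset.mem_insert_self _ _)) hyv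
  have hxyf : x ∉ insert y f := by simp [hxy, hxf]
  have hc : insert x (insert y f) ∈ degSet I J (d + 2) :=
    ⟨mem_sqPoset_of_inf hle (mem_sqPoset_of_subset hy (hF.1 _ hv).2.1 (Finset.subset_insert _ _)
      hcv), hins hxyf (hins hyf hf.2)⟩
  obtain ⟨ψ, hψ⟩ := hF.exists_between (k := d + 1) hFd (U := U.filter fun u => ¬ (f ⊆ u ∧ u ⊆ v))
    fun u hu => by
      obtain ⟨huU, hu⟩ := Finset.mem_filter.mp hu
      refine ⟨(hU u huU).2, ?_⟩
      obtain ⟨⟨t, v'⟩, ⟨hp, htu, huv'⟩, -⟩ := hF.2 u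
        (mem_sqPoset_inf.mpr ⟨⟨u, Set.mem_insert_of_mem _ huU, subset_rfl⟩, (hU u huU).1.2⟩)
      obtain ⟨⟨g, hg, hgt⟩, -⟩ := mem_sqPoset_inf.mp (hF.1 _ hp).1
      rcases hcardG g hg with rfl | hg
      · refine ⟨v', ?_⟩
        by_cases htg : t = g
        · subst htg
          obtain rfl := congrArg Prod.snd (hF.eq_of_mem hv hp subset_rfl hfv subset_rfl
            (hF.1 _ hp).2.2)
          exact absurd ⟨hgt.trans htu, huv'⟩ hu
        · rwa [← Finset.eq_of_subset_of_card_le htu]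
          have := Finset.card_lt_card (hgt.ssubset_of_ne (Ne.symm htg))
          have h1 := hf.2
          have h2 := (hU u huU).2
          omega
      · refine ⟨v', ?_⟩
        rwa [← Finset.eq_of_subset_of_card_le htu]
        exact ((hU u huU).2.trans hg.symm).le.trans (Finset.card_le_card hgt)
  have hpart : ∀ z ∈ U \ {insert x f, insert y f}, f ⊆ z → z ⊆ v → x ∉ z ∧ insert x z ⊆ v := by
    intro z hz hfz hzv
    simp only [Finset.mem_sdiff, Finset.mem_insert, Finset.mem_singleton, not_or] at hz
    refine ⟨fun hxz => hz.2.1 ?_, Finset.insert_subset (hxv (Finset.mem_insert_self _ _)) hzv⟩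
    exact (Finset.eq_of_subset_of_card_le (Finset.insert_subset hxz hfz)
      ((hU z hz.1).2.trans (hins hxf hf.2).symm).le).symm
  have hout : ∀ z ∈ U \ {insert x f, insert y f}, ¬ (f ⊆ z ∧ z ⊆ v) →
      z ∈ U.filter fun u => ¬ (f ⊆ u ∧ u ⊆ v) := fun z hz h' =>
    Finset.mem_filter.mpr ⟨(Finset.mem_sdiff.mp hz).1, h'⟩
  have hψv : ∀ z ∈ U \ {insert x f, insert y f}, ¬ (f ⊆ z ∧ z ⊆ v) → ¬ (f ⊆ ψ z ∧ ψ z ⊆ v) := by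
    intro z hz hzf hcon
    obtain ⟨v', hv', hzψ, hψv', -, -⟩ := hψ z (hout z hz hzf)
    obtain ⟨rfl, rfl⟩ := Prod.mk.inj (hF.eq_of_mem hv hv' hcon.1 hcon.2 hzψ hψv')
    exact hzf ⟨subset_rfl, hfv⟩
  refine ⟨insert x f, ⟨mem_sqPoset_of_inf hle hx, hins hxf hf.2⟩, Finset.subset_insert _ _,
    insert y f, ⟨mem_sqPoset_of_inf hle hy, hins hyf hf.2⟩, Finset.subset_insert _ _,
    fun hxy' => hxyf (hxy' ▸ Finset.mem_insert_self _ _), insert x (insert y f),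
    mem_degMultiples.mpr ⟨Finset.insert_subset_insert _ (Finset.subset_insert _ _), hc⟩,
    mem_degMultiples.mpr ⟨Finset.subset_insert _ _, hc⟩,
    fun z => if f ⊆ z ∧ z ⊆ v then insert x z else ψ z, fun z hz z' hz' hzz' => ?_, fun z hz => ?_⟩
  · rw [Finset.mem_coe] at hz hz'
    by_cases h1 : f ⊆ z ∧ z ⊆ v <;> by_cases h2 : f ⊆ z' ∧ z' ⊆ v <;>
      simp only [h1, h2, if_true, if_false, and_self] at hzz'
    · rw [← Finset.erase_insert (hpart z hz h1.1 h1.2).1, hzz',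
        Finset.erase_insert (hpart z' hz' h2.1 h2.2).1]
    · exact absurd (hzz' ▸ ⟨h1.1.trans (Finset.subset_insert _ _), (hpart z hz h1.1 h1.2).2⟩)
        (hψv z' hz' h2)
    · exact absurd (hzz' ▸ ⟨h2.1.trans (Finset.subset_insert _ _), (hpart z' hz' h2.1 h2.2).2⟩)
        (hψv z hz h1)
    · obtain ⟨u, hu, huψ, hψu, -, -⟩ := hψ z (hout z hz h1)
      obtain ⟨u', hu', huψ', hψu', -, -⟩ := hψ z' (hout z' hz' h2)
      exact congrArg Prod.fst (hF.eq_of_mem hu hu' huψ hψu (hzz' ▸ huψ') (hzz' ▸ hψu'))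
  · by_cases h1 : f ⊆ z ∧ z ⊆ v <;> simp only [h1, if_true, if_false, and_self]
    · have hzU := (Finset.mem_sdiff.mp hz).1
      obtain ⟨hxz, hxzv⟩ := hpart z hz h1.1 h1.2
      refine ⟨mem_degMultiples.mpr ⟨Finset.subset_insert _ _, mem_sqPoset_of_subset (hU z hzU).1
        (mem_sqPoset_of_inf hle (hF.1 _ hv).2.1) (Finset.subset_insert _ _) hxzv,
        hins hxz (hU z hzU).2⟩, fun h' => ?_⟩
      rw [Finset.mem_singleton] at h'
      have : z = insert y f := by
        rw [← Finset.erase_insert hxz, h', Finset.erase_insert hxyf]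
      simp [this] at hz
    · obtain ⟨u, hu, huψ, hψu, hcard, hmem⟩ := hψ z (hout z hz h1)
      refine ⟨mem_degMultiples.mpr ⟨huψ, mem_sqPoset_of_inf hle hmem, hcard⟩, fun h' => ?_⟩
      rw [Finset.mem_singleton] at h'
      exact hψv z hz h1 ⟨h' ▸ (Finset.subset_insert _ _).trans (Finset.subset_insert _ _), h' ▸ hcv⟩

theorem exists_disjoint_pairs_of_le_sdepth {f₁ f₂ : Finset (Fin n)} (hf₁ : f₁ ∈ degSet I J d)
    (hf₂ : f₂ ∈ degSet I J d) (hne : f₁ ≠ f₂) {U : Set (Finset (Fin n))}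
    (hU : ∀ u ∈ U, u ∈ degSet I J (d + 1))
    (h : d + 2 ≤ sdepth (Ideal.span (sqm K '' (insert f₁ (insert f₂ U))))
      (J ⊓ Ideal.span (sqm K '' (insert f₁ (insert f₂ U))))) :
    ∃ a₁ ∈ degSet I J (d + 1), ∃ b₁ ∈ degSet I J (d + 1), ∃ a₂ ∈ degSet I J (d + 1),
      ∃ b₂ ∈ degSet I J (d + 1), f₁ ⊆ a₁ ∧ f₁ ⊆ b₁ ∧ a₁ ≠ b₁ ∧ f₂ ⊆ a₂ ∧ f₂ ⊆ b₂ ∧ a₂ ≠ b₂ ∧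
        ∀ w, w = a₁ ∨ w = b₁ → w = a₂ ∨ w = b₂ → False := by
  obtain ⟨F, hF, hFd⟩ := exists_partition_of_le_sdepth (Nat.succ_pos _) h
  have hG : ∀ g ∈ insert f₁ (insert f₂ U), g ∈ sqPoset I J ∧ d ≤ g.card := by
    rintro g (rfl | rfl | hg)
    · exact ⟨hf₁.1, hf₁.2.ge⟩
    · exact ⟨hf₂.1, hf₂.2.ge⟩
    · exact ⟨(hU g hg).1, (hU g hg).2 ▸ Nat.le_succ d⟩
  have hle := span_sqm_le_of_degSet fun g hg => (hG g hg).1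
  have key : ∀ f ∈ insert f₁ (insert f₂ U), f.card = d → ∃ v, (f, v) ∈ F ∧
      ∃ a ∈ degSet I J (d + 1), ∃ b ∈ degSet I J (d + 1),
        f ⊆ a ∧ a ⊆ v ∧ f ⊆ b ∧ b ⊆ v ∧ a ≠ b := by
    intro f hfG hfd
    obtain ⟨v, hv, -⟩ := hF.exists_mem_of_minimal
      (mem_sqPoset_inf.mpr ⟨⟨f, hfG, subset_rfl⟩, (hG f hfG).1.2⟩) fun S hS hSf => by
        obtain ⟨⟨g, hg, hgS⟩, -⟩ := mem_sqPoset_inf.mp hS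
        exact Finset.eq_of_subset_of_card_le hSf
          (hfd.le.trans ((hG g hg).2.trans (Finset.card_le_card hgS)))
    obtain ⟨x, y, hxf, hyf, hxy, hxv, hyv, hx, hy⟩ := hF.exists_pair hv hfd (hFd _ hv)
    exact ⟨v, hv, insert x f,
      ⟨mem_sqPoset_of_inf hle hx, hfd ▸ Finset.card_insert_of_notMem hxf⟩, insert y f,
      ⟨mem_sqPoset_of_inf hle hy, hfd ▸ Finset.card_insert_of_notMem hyf⟩,
      Finset.subset_insert _ _, hxv, Finset.subset_insert _ _, hyv,
      fun h' => hxy ((Finset.insert_inj hxf).mp h')⟩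
  obtain ⟨v₁, hv₁, a₁, ha₁, b₁, hb₁, hfa₁, hav₁, hfb₁, hbv₁, hab₁⟩ :=
    key f₁ (Set.mem_insert _ _) hf₁.2
  obtain ⟨v₂, hv₂, a₂, ha₂, b₂, hb₂, hfa₂, hav₂, hfb₂, hbv₂, hab₂⟩ :=
    key f₂ (Set.mem_insert_of_mem _ (Set.mem_insert _ _)) hf₂.2
  refine ⟨a₁, ha₁, b₁, hb₁, a₂, ha₂, b₂, hb₂, hfa₁, hfb₁, hab₁, hfa₂, hfb₂, hab₂, ?_⟩
  rintro w hw₁ hw₂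
  have h₁ : f₁ ⊆ w ∧ w ⊆ v₁ := by rcases hw₁ with rfl | rfl <;> exact ⟨‹_›, ‹_›⟩
  have h₂ : f₂ ⊆ w ∧ w ⊆ v₂ := by rcases hw₂ with rfl | rfl <;> exact ⟨‹_›, ‹_›⟩
  exact hne (congrArg Prod.fst (hF.eq_of_mem hv₁ hv₂ h₁.1 h₁.2 h₂.1 h₂.2))

end IntervalPartitions

section PairSolutions

variable {K : Type*} [Field K] {n : ℕ} {I J : Ideal (MvPolynomial (Fin n) K)} {d : ℕ}

theorem eq_or_eq_of_subset_of_subset {f a b c T : Finset (Fin n)} (hf : f.card = d)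
    (ha : a.card = d + 1) (hb : b.card = d + 1) (hc : c.card = d + 2) (hfa : f ⊆ a) (hfb : f ⊆ b)
    (hab : a ≠ b) (hac : a ⊆ c) (hbc : b ⊆ c) (hT : T.card = d + 1) (hfT : f ⊆ T) (hTc : T ⊆ c) :
    T = a ∨ T = b := by
  obtain ⟨x, hx, rfl⟩ := Finset.exists_eq_insert_iff.mpr ⟨hfa, by omega⟩
  obtain ⟨y, hy, rfl⟩ := Finset.exists_eq_insert_iff.mpr ⟨hfb, by omega⟩
  obtain ⟨t, ht, rfl⟩ := Finset.exists_eq_insert_iff.mpr ⟨hfT, by omega⟩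
  have hxy : x ∉ insert y f := by
    rw [Finset.mem_insert, not_or]
    exact ⟨fun h => hab (h ▸ rfl), hx⟩
  obtain rfl : insert x (insert y f) = c := Finset.eq_of_subset_of_card_le
    (Finset.insert_subset (hac (Finset.mem_insert_self _ _)) hbc)
    (by rw [Finset.card_insert_of_notMem hxy]; omega)
  have := hTc (Finset.mem_insert_self _ _)
  rw [Finset.mem_insert, Finset.mem_insert] at this
  rcases this with rfl | rfl | h
  · exact Or.inl rfl
  · exact Or.inr rfl
  · exact absurd h ht

theorem mem_interval_iff {f a b c T : Finset (Fin n)} (hf : f.card = d)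
    (ha : a.card = d + 1) (hb : b.card = d + 1) (hc : c.card = d + 2) (hfa : f ⊆ a) (hfb : f ⊆ b)
    (hab : a ≠ b) (hac : a ⊆ c) (hbc : b ⊆ c) :
    f ⊆ T ∧ T ⊆ c ↔ T = f ∨ T = a ∨ T = b ∨ T = c := by
  refine ⟨fun ⟨hfT, hTc⟩ => ?_, ?_⟩
  · have h1 := Finset.card_le_card hfT
    have h2 := Finset.card_le_card hTc
    obtain h | h | h : T.card ≤ d ∨ T.card = d + 1 ∨ d + 2 ≤ T.card := by omega
    · exact Or.inl (Finset.eq_of_subset_of_card_le hfT (by omega)).symm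
    · have := eq_or_eq_of_subset_of_subset hf ha hb hc hfa hfb hab hac hbc h hfT hTc
      tauto
    · exact Or.inr (Or.inr (Or.inr (Finset.eq_of_subset_of_card_le hTc (by omega))))
  · rintro (rfl | rfl | rfl | rfl)
    exacts [⟨subset_rfl, hfa.trans hac⟩, ⟨hfa, hac⟩, ⟨hfb, hbc⟩, ⟨hfa.trans hac, subset_rfl⟩]

theorem mem_interval_iff_of_card_eq {b c T : Finset (Fin n)} (hb : b.card = d + 1)
    (hc : c.card = d + 2) (hbc : b ⊆ c) : b ⊆ T ∧ T ⊆ c ↔ T = b ∨ T = c := by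
  refine ⟨fun ⟨hbT, hTc⟩ => ?_, ?_⟩
  · have h1 := Finset.card_le_card hbT
    have h2 := Finset.card_le_card hTc
    obtain h | h : T.card ≤ d + 1 ∨ d + 2 ≤ T.card := by omega
    · exact Or.inl (Finset.eq_of_subset_of_card_le hbT (by omega)).symm
    · exact Or.inr (Finset.eq_of_subset_of_card_le hTc (by omega))
  · rintro (rfl | rfl)
    exacts [⟨subset_rfl, hbc⟩, ⟨hbc, subset_rfl⟩]

theorem disjoint_quadruple_pair {f a b c z y T : Finset (Fin n)} (hf : f.card = d)
    (ha : a.card = d + 1) (hb : b.card = d + 1) (hc : c.card = d + 2) (hz : z.card = d + 1)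
    (hza : z ≠ a) (hzb : z ≠ b) (hy : y.card = d + 2) (hyc : y ≠ c)
    (hT : T = f ∨ T = a ∨ T = b ∨ T = c) : ¬ (T = z ∨ T = y) := by
  rintro (rfl | rfl) <;> rcases hT with rfl | rfl | rfl | rfl <;>
    first | contradiction | omega

open Classical in
theorem le_sdepth_of_pairSolution {f₁ f₂ : Finset (Fin n)} (hf₁ : f₁ ∈ degSet I J d)
    (hf₂ : f₂ ∈ degSet I J d) (hne : f₁ ≠ f₂)
    (hP : ∀ T ∈ sqPoset I J, T = f₁ ∨ T = f₂ ∨ d + 1 ≤ T.card) {B : Finset (Finset (Fin n))}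
    (hB : ∀ b, b ∈ B ↔ b ∈ degSet I J (d + 1))
    (h : PairSolution (degMultiples I J (d + 2)) B (B.filter (f₁ ⊆ ·)) (B.filter (f₂ ⊆ ·))) :
    d + 2 ≤ sdepth I J := by
  obtain ⟨a, ha, b, hb, a', ha', b', hb', hab, hab', haa', hab'', hba', hbb', c, hca, hcb, c',
    hca', hcb', hcc', φ, hφ, hφN⟩ := h
  simp only [Finset.mem_filter, hB, mem_degMultiples] at ha hb ha' hb' hca hcb hca' hcb'
  have hR : ∀ z, z ∈ B \ {a, b, a', b'} ↔
      z ∈ degSet I J (d + 1) ∧ z ≠ a ∧ z ≠ b ∧ z ≠ a' ∧ z ≠ b' := fun z => by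
    simp [hB]
  have hφ' : ∀ z ∈ B \ {a, b, a', b'}, z ⊆ φ z ∧ φ z ∈ degSet I J (d + 2) ∧ φ z ≠ c ∧ φ z ≠ c' :=
    fun z hz => by
      have := hφN z hz
      rw [mem_degMultiples] at this
      simpa [and_assoc] using this
  have int₁ := fun T => mem_interval_iff (T := T) hf₁.2 ha.1.2 hb.1.2 hca.2.2 ha.2 hb.2 hab hca.1
    hcb.1
  have int₂ := fun T => mem_interval_iff (T := T) hf₂.2 ha'.1.2 hb'.1.2 hca'.2.2 ha'.2 hb'.2 hab'
    hca'.1 hcb'.1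
  have intR := fun z (hz : z ∈ B \ {a, b, a', b'}) T =>
    mem_interval_iff_of_card_eq (T := T) ((hR z).mp hz).1.2 (hφ' z hz).2.1.2 (hφ' z hz).1
  let Q : Finset (Finset (Fin n)) := Finset.univ.filter fun T => T ∈ sqPoset I J ∧
    d + 2 ≤ T.card ∧ T ≠ c ∧ T ≠ c' ∧ ∀ z ∈ B \ {a, b, a', b'}, T ≠ φ z
  have hQ : ∀ T, T ∈ Q ↔ T ∈ sqPoset I J ∧
    d + 2 ≤ T.card ∧ T ≠ c ∧ T ≠ c' ∧ ∀ z ∈ B \ {a, b, a', b'}, T ≠ φ z := fun T => by simp [Q]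
  let F : Finset (Finset (Fin n) × Finset (Fin n)) := {(f₁, c), (f₂, c')} ∪
    (B \ {a, b, a', b'}).image (fun z => (z, φ z)) ∪ Q.image fun T => (T, T)
  have hF : ∀ p, p ∈ F ↔ p = (f₁, c) ∨ p = (f₂, c') ∨ (∃ z ∈ B \ {a, b, a', b'}, (z, φ z) = p) ∨
      ∃ T ∈ Q, (T, T) = p := fun p => by
    simp only [F, Finset.mem_union, Finset.mem_insert, Finset.mem_singleton, Finset.mem_image,
      or_assoc]
  have hdisj : ∀ p ∈ F, ∀ q ∈ F, ∀ T, p.1 ⊆ T ∧ T ⊆ p.2 → q.1 ⊆ T ∧ T ⊆ q.2 → p = q := by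
    have hf₁d := hf₁.2
    have hf₂d := hf₂.2
    have had := ha.1.2
    have hbd := hb.1.2
    have had' := ha'.1.2
    have hbd' := hb'.1.2
    have hcd := hca.2.2
    have hcd' := hca'.2.2
    have hRd : ∀ z ∈ B \ {a, b, a', b'}, z.card = d + 1 ∧ z ≠ a ∧ z ≠ b ∧ z ≠ a' ∧ z ≠ b' ∧
        (φ z).card = d + 2 ∧ φ z ≠ c ∧ φ z ≠ c' := fun z hz =>
      have h := (hR z).mp hz
      ⟨h.1.2, h.2.1, h.2.2.1, h.2.2.2.1, h.2.2.2.2, (hφ' z hz).2.1.2, (hφ' z hz).2.2⟩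
    have hloc : ∀ p ∈ F, ∀ T, p.1 ⊆ T ∧ T ⊆ p.2 →
        (p = (f₁, c) ∧ (T = f₁ ∨ T = a ∨ T = b ∨ T = c)) ∨
        (p = (f₂, c') ∧ (T = f₂ ∨ T = a' ∨ T = b' ∨ T = c')) ∨
        (∃ z ∈ B \ {a, b, a', b'}, p = (z, φ z) ∧ (T = z ∨ T = φ z)) ∨
        (p = (T, T) ∧ T ∈ Q) := by
      intro p hp T hT
      rcases (hF p).mp hp with rfl | rfl | ⟨z, hz, rfl⟩ | ⟨S, hS, rfl⟩
      · exact Or.inl ⟨rfl, (int₁ T).mp hT⟩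
      · exact Or.inr (Or.inl ⟨rfl, (int₂ T).mp hT⟩)
      · exact Or.inr (Or.inr (Or.inl ⟨z, hz, rfl, (intR z hz T).mp hT⟩))
      · obtain rfl := hT.1.antisymm hT.2
        exact Or.inr (Or.inr (Or.inr ⟨rfl, hS⟩))
    intro p hp q hq T hpT hqT
    have hQ₁ : T ∈ Q → ¬ (T = f₁ ∨ T = a ∨ T = b ∨ T = c) := by
      rintro hT (rfl | rfl | rfl | rfl) <;> have := (hQ _).mp hT
      exacts [by omega, by omega, by omega, this.2.2.1 rfl]
    have hQ₂ : T ∈ Q → ¬ (T = f₂ ∨ T = a' ∨ T = b' ∨ T = c') := by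
      rintro hT (rfl | rfl | rfl | rfl) <;> have := (hQ _).mp hT
      exacts [by omega, by omega, by omega, this.2.2.2.1 rfl]
    have hQR : ∀ z ∈ B \ {a, b, a', b'}, T ∈ Q → ¬ (T = z ∨ T = φ z) := by
      rintro z hz hT (rfl | rfl) <;> have := (hQ _).mp hT
      exacts [by have := hRd T hz; omega, this.2.2.2.2 z hz rfl]
    have h₁₂ : (T = f₁ ∨ T = a ∨ T = b ∨ T = c) → ¬ (T = f₂ ∨ T = a' ∨ T = b' ∨ T = c') := by
      rintro (rfl | rfl | rfl | rfl) (rfl | rfl | rfl | rfl) <;> first | contradiction | omega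
    have hR₁ : ∀ z ∈ B \ {a, b, a', b'}, (T = f₁ ∨ T = a ∨ T = b ∨ T = c) →
        ¬ (T = z ∨ T = φ z) := by
      intro z hz
      obtain ⟨hzd, hza, hzb, hza', hzb', hφd, hφc, hφc'⟩ := hRd z hz
      exact disjoint_quadruple_pair hf₁d had hbd hcd hzd hza hzb hφd hφc
    have hR₂ : ∀ z ∈ B \ {a, b, a', b'}, (T = f₂ ∨ T = a' ∨ T = b' ∨ T = c') →
        ¬ (T = z ∨ T = φ z) := by
      intro z hz
      obtain ⟨hzd, hza, hzb, hza', hzb', hφd, hφc, hφc'⟩ := hRd z hz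
      exact disjoint_quadruple_pair hf₂d had' hbd' hcd' hzd hza' hzb' hφd hφc'
    rcases hloc p hp T hpT with ⟨rfl, h₁⟩ | ⟨rfl, h₁⟩ | ⟨z, hz, rfl, h₁⟩ | ⟨rfl, h₁⟩ <;>
      rcases hloc q hq T hqT with ⟨rfl, h₂⟩ | ⟨rfl, h₂⟩ | ⟨y, hy, rfl, h₂⟩ | ⟨rfl, h₂⟩
    · rfl
    · exact absurd h₂ (h₁₂ h₁)
    · exact absurd h₂ (hR₁ y hy h₁)
    · exact absurd h₁ (hQ₁ h₂)
    · exact absurd h₁ (h₁₂ h₂)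
    · rfl
    · exact absurd h₂ (hR₂ y hy h₁)
    · exact absurd h₁ (hQ₂ h₂)
    · exact absurd h₁ (hR₁ z hz h₂)
    · exact absurd h₁ (hR₂ z hz h₂)
    · have h₃ := hRd z hz
      have h₄ := hRd y hy
      obtain rfl : z = y := by
        rcases h₁ with rfl | rfl <;> rcases h₂ with h | h
        · exact h
        · exact absurd (congrArg Finset.card h) (by omega)
        · exact absurd (congrArg Finset.card h) (by omega)
        · exact hφ hz hy h
      rfl
    · exact absurd h₁ (hQR z hz h₂)
    · exact absurd h₂ (hQ₁ h₁)
    · exact absurd h₂ (hQ₂ h₁)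
    · exact absurd h₂ (hQR y hy h₁)
    · rfl
  refine le_sdepth ⟨f₁, hf₁.1⟩ (F := F) ⟨fun p hp => ?_, fun T hT => ?_⟩ fun p hp => ?_
  · rcases (hF p).mp hp with rfl | rfl | ⟨z, hz, rfl⟩ | ⟨T, hT, rfl⟩
    · exact ⟨hf₁.1, hca.2.1, ha.2.trans hca.1⟩
    · exact ⟨hf₂.1, hca'.2.1, ha'.2.trans hca'.1⟩
    · exact ⟨((hR z).mp hz).1.1, (hφ' z hz).2.1.1, (hφ' z hz).1⟩
    · exact ⟨((hQ T).mp hT).1, ((hQ T).mp hT).1, subset_rfl⟩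
  · refine existsUnique_of_exists_of_unique ?_ fun p q hp hq => hdisj p hp.1 q hq.1 T hp.2 hq.2
    by_cases h₁ : T = f₁ ∨ T = a ∨ T = b ∨ T = c
    · exact ⟨_, (hF _).mpr (Or.inl rfl), (int₁ T).mpr h₁⟩
    by_cases h₂ : T = f₂ ∨ T = a' ∨ T = b' ∨ T = c'
    · exact ⟨_, (hF _).mpr (Or.inr (Or.inl rfl)), (int₂ T).mpr h₂⟩
    by_cases h₃ : ∃ z ∈ B \ {a, b, a', b'}, T = z ∨ T = φ z
    · obtain ⟨z, hz, hzT⟩ := h₃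
      exact ⟨_, (hF _).mpr (Or.inr (Or.inr (Or.inl ⟨z, hz, rfl⟩))), (intR z hz T).mpr hzT⟩
    · refine ⟨_, (hF _).mpr (Or.inr (Or.inr (Or.inr ⟨T, (hQ T).mpr ⟨hT, ?_, ?_, ?_, ?_⟩, rfl⟩))),
        subset_rfl, subset_rfl⟩
      · by_contra hcard
        have hT1 : T.card = d + 1 := by
          rcases hP T hT with h | h | h
          · tauto
          · tauto
          · omega
        exact h₃ ⟨T, (hR T).mpr ⟨⟨hT, hT1⟩, by tauto⟩, Or.inl rfl⟩
      · tauto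
      · tauto
      · exact fun z hz hTz => h₃ ⟨z, hz, Or.inr hTz⟩
  · rcases (hF p).mp hp with rfl | rfl | ⟨z, hz, rfl⟩ | ⟨T, hT, rfl⟩
    · exact hca.2.2.ge
    · exact hca'.2.2.ge
    · exact (hφ' z hz).2.1.2.ge
    · exact ((hQ T).mp hT).2.1

end PairSolutions

section CriticalPairs

variable {K : Type*} [Field K] {n : ℕ} {d : ℕ}

theorem pair_of_mem_degMultiples {I J : Ideal (MvPolynomial (Fin n) K)} {f a c : Finset (Fin n)}
    (hf : f ∈ degSet I J d) (ha : a ∈ degSet I J (d + 1)) (hfa : f ⊆ a)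
    (hc : c ∈ degMultiples I J (d + 2) a) :
    ∃ b ∈ degSet I J (d + 1), f ⊆ b ∧ b ≠ a ∧ c ∈ degMultiples I J (d + 2) b := by
  obtain ⟨hac, hcd⟩ := mem_degMultiples.mp hc
  obtain ⟨x, hx, rfl⟩ := Finset.exists_eq_insert_iff.mpr ⟨hfa, by rw [hf.2, ha.2]⟩
  obtain ⟨y, hy, rfl⟩ := Finset.exists_eq_insert_iff.mpr ⟨hac, by rw [ha.2, hcd.2]⟩
  rw [Finset.mem_insert, not_or] at hy
  have hsub : insert y f ⊆ insert y (insert x f) := Finset.insert_subset_insert _ hfa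
  refine ⟨insert y f, ⟨mem_sqPoset_of_subset hf.1 hcd.1 (Finset.subset_insert _ _) hsub, ?_⟩,
    Finset.subset_insert _ _, fun h => ?_, mem_degMultiples.mpr ⟨hsub, hcd⟩⟩
  · rw [Finset.card_insert_of_notMem hy.2, hf.2]
  · exact hy.1 ((Finset.insert_inj hy.2).mp h)

theorem union_eq_of_card_eq_add_one {a b c : Finset (Fin n)} (ha : a.card = d) (hb : b.card = d)
    (hc : c.card = d + 1) (hab : a ≠ b) (hac : a ⊆ c) (hbc : b ⊆ c) : a ∪ b = c := by
  refine Finset.eq_of_subset_of_card_le (Finset.union_subset hac hbc) ?_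
  have hss : a ⊂ a ∪ b := Finset.subset_union_left.ssubset_of_ne fun h => hab <|
    (Finset.eq_of_subset_of_card_le (Finset.union_eq_left.mp h.symm) (ha.trans hb.symm).le).symm
  have := Finset.card_lt_card hss
  omega

theorem span_sqm_ne_bot {G : Set (Finset (Fin n))} (hG : G.Nonempty) :
    Ideal.span (sqm K '' G) ≠ ⊥ := by
  obtain ⟨g, hg⟩ := hG
  refine fun h => ?_
  have hmem : sqm K g ∈ (⊥ : Ideal (MvPolynomial (Fin n) K)) :=
    h ▸ Ideal.subset_span (Set.mem_image_of_mem _ hg)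
  exact Finset.prod_ne_zero_iff.mpr (fun i _ => X_ne_zero i) (Ideal.mem_bot.mp hmem)

theorem span_sqm_lt {G : Set (Finset (Fin n))} {I : Ideal (MvPolynomial (Fin n) K)}
    (hG : ∀ g ∈ G, sqm K g ∈ I) {T : Finset (Fin n)} (hT : sqm K T ∈ I) (hTG : ∀ g ∈ G, ¬ g ⊆ T) :
    Ideal.span (sqm K '' G) < I :=
  lt_of_le_of_ne (span_sqm_le_iff.mpr hG) fun h => by
    obtain ⟨g, hg, hgT⟩ := sqm_mem_span_iff.mp (h.symm ▸ hT)
    exact hTG g hg hgT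

end CriticalPairs

/-- the key lemma for `r = 2`. -/
theorem statement7 {K : Type*} [Field K] {n : ℕ} (d : ℕ) (hd : 0 < d)
    (I J : Ideal (MvPolynomial (Fin n) K)) (hJI : J < I)
    (f₁ f₂ : Finset (Fin n)) (hf1 : f₁.card = d) (hf2 : f₂.card = d) (hne : f₁ ≠ f₂)
    (E : Set (Finset (Fin n))) (hE : ∀ T ∈ E, d + 1 ≤ T.card)
    (hI : I = Ideal.span (sqm K '' (({f₁, f₂} : Set (Finset (Fin n))) ∪ E)))
    (hmin : ∀ g ∈ ({f₁, f₂} : Set (Finset (Fin n))) ∪ E,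
      sqm K g ∉ Ideal.span (sqm K '' ((({f₁, f₂} : Set (Finset (Fin n))) ∪ E) \ {g})))
    (hJ : SqfreeGenFrom J (d + 1))
    (hs1 : 4 ≤ (degSet I J (d + 1)).ncard)
    (hs2 : (degSet I J (d + 1)).ncard ≤ (degSet I J (d + 2)).ncard + 2)
    (hC : ∀ T ∈ degSet I J (d + 2),
      sqm K T ∈ Ideal.span {sqm K f₁} ⊓ Ideal.span {sqm K f₂} ∨
      sqm K T ∈ Ideal.span (sqm K '' E) ⊓ Ideal.span {sqm K f₁, sqm K f₂} ∨
      ∃ a ∈ E, ∃ a' ∈ E, a ≠ a' ∧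
        sqm K T ∈ Ideal.span {sqm K a} ⊓ Ideal.span {sqm K a'})
    (hb : ∃ b ∈ degSet I J (d + 1),
      sqm K b ∈ Ideal.span {sqm K f₁} ∧ sqm K b ∉ Ideal.span {sqm K f₂} ∧
      d + 2 ≤ sdepth
        (Ideal.span (insert (sqm K f₂) (sqm K '' (degSet I J (d + 1) \ {b}))))
        (J ⊓ Ideal.span (insert (sqm K f₂) (sqm K '' (degSet I J (d + 1) \ {b}))))) :
    d + 2 ≤ sdepth I J ∨
    ∃ G' ⊆ ({f₁, f₂} : Set (Finset (Fin n))) ∪ degSet I J (d + 1),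
      Ideal.span (sqm K '' G') ≠ ⊥ ∧ Ideal.span (sqm K '' G') < I ∧
      sdepth (Ideal.span (sqm K '' G')) (J ⊓ Ideal.span (sqm K '' G')) ≤ d + 1 ∧
      d + 1 ≤ depthIJ I (J ⊔ Ideal.span (sqm K '' G')) := by
    classical
  obtain ⟨GJ, hGJ, rfl⟩ := hJ
  subst hI
  set H : Set (Finset (Fin n)) := {f₁, f₂} ∪ E with hHdef
  set I := Ideal.span (sqm K '' H) with hI
  set J := Ideal.span (sqm K '' GJ) with hJ
  by_contra hcon
  push Not at hcon
  obtain ⟨hsd, hno⟩ := hcon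
  have hfH₁ : f₁ ∈ H := Or.inl (Or.inl rfl)
  have hfH₂ : f₂ ∈ H := Or.inl (Or.inr rfl)
  have hH : ∀ g ∈ H, g ≠ f₁ → g ≠ f₂ → d + 1 ≤ g.card := by
    rintro g ((rfl | rfl) | hg) h₁ h₂
    exacts [absurd rfl h₁, absurd rfl h₂, hE g hg]
  have hGJH : ∀ g ∈ GJ, ∃ h ∈ H, h ⊆ g := fun g hg =>
    sqm_mem_span_iff.mp (hJI.le (Ideal.subset_span (Set.mem_image_of_mem _ hg)))
  have hnJ : ∀ {T}, sqm K T ∉ J ↔ ∀ g ∈ GJ, ¬ g ⊆ T := fun {T} => by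
    rw [hJ, sqm_mem_span_iff]
    push Not
    rfl
  have hfP : ∀ f ∈ H, f.card = d → f ∈ degSet I J d := fun f hfH hfd =>
    ⟨⟨Ideal.subset_span (Set.mem_image_of_mem _ hfH), hnJ.mpr fun g hg hgf => by
      have := Finset.card_le_card hgf
      have := hGJ g hg
      omega⟩, hfd⟩
  have hP₁ := hfP f₁ hfH₁ hf1
  have hP₂ := hfP f₂ hfH₂ hf2
  have hP : ∀ T ∈ sqPoset I J, T = f₁ ∨ T = f₂ ∨ d + 1 ≤ T.card := by
    intro T hT
    obtain ⟨g, hg, hgT⟩ := sqm_mem_span_iff.mp hT.1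
    by_contra! hcon
    have h1 := Finset.card_le_card hgT
    by_cases hg₁ : g = f₁
    · exact hcon.1 (Finset.eq_of_subset_of_card_le (hg₁ ▸ hgT) (by omega)).symm
    by_cases hg₂ : g = f₂
    · exact hcon.2.1 (Finset.eq_of_subset_of_card_le (hg₂ ▸ hgT) (by omega)).symm
    · have := hH g hg hg₁ hg₂
      omega
  let B : Finset (Finset (Fin n)) := (degSet I J (d + 1)).toFinset
  have hB : ∀ b, b ∈ B ↔ b ∈ degSet I J (d + 1) := fun b => Set.mem_toFinset
  have hBs : 4 ≤ B.card := by rwa [← Set.ncard_eq_toFinset_card']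
  have hns : ∀ u ∈ degSet I J (d + 1), ∀ g ∈ degSet I J (d + 1), u ≠ g → ¬ g ⊆ u :=
    fun u hu g hg hug h =>
      hug (Finset.eq_of_subset_of_card_le h (hu.2.trans hg.2.symm).le).symm
  have hnf : ∀ f ∈ degSet I J d, ∀ g ∈ degSet I J (d + 1), ¬ g ⊆ f := fun f hf g hg h => by
    have := Finset.card_le_card h
    rw [hf.2, hg.2] at this
    omega
  have key : ∀ G' ⊆ ({f₁, f₂} : Set (Finset (Fin n))) ∪ degSet I J (d + 1), G'.Nonempty →
      ∀ T ∈ sqPoset I J, (∀ g ∈ G', ¬ g ⊆ T) → ∀ m₁ m₂ : Finset (Fin n),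
      ((∀ g ∈ G', ¬ g ⊆ f₁) → f₁ ⊆ m₁ ∧ m₁ ∈ degSet I J (d + 1) ∧ ∀ g ∈ G', ¬ g ⊆ m₁) →
      ((∀ g ∈ G', ¬ g ⊆ f₂) → f₂ ⊆ m₂ ∧ m₂ ∈ degSet I J (d + 1) ∧ ∀ g ∈ G', ¬ g ⊆ m₂) →
      ((∀ g ∈ G', ¬ g ⊆ f₁) → ¬ f₂ ⊆ m₁) ∨ ((∀ g ∈ G', ¬ g ⊆ f₂) → ¬ f₁ ⊆ m₂) →
      d + 2 ≤ sdepth (Ideal.span (sqm K '' G')) (J ⊓ Ideal.span (sqm K '' G')) := by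
    intro G' hG' hG'ne T hT hTG m₁ m₂ h₁ h₂ h₁₂
    have hG'P : ∀ g ∈ G', g ∈ sqPoset I J := by
      intro g hg
      rcases hG' hg with (rfl | rfl) | hg
      exacts [hP₁.1, hP₂.1, hg.1]
    have hsup : J ⊔ Ideal.span (sqm K '' G') = Ideal.span (sqm K '' (GJ ∪ G')) := by
      rw [Set.image_union, Ideal.span_union]
    have hHG : ∀ g ∈ GJ ∪ G', ∃ h ∈ H, h ⊆ g := by
      rintro g (hg | hg)
      · exact hGJH g hg
      · exact sqm_mem_span_iff.mp (hG'P g hg).1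
    have hU : ∀ {S}, (∀ g ∈ GJ ∪ G', ¬ g ⊆ S) ↔ sqm K S ∉ J ∧ ∀ g ∈ G', ¬ g ⊆ S := fun {S} => by
      rw [hnJ]
      exact ⟨fun h => ⟨fun g hg => h g (Or.inl hg), fun g hg => h g (Or.inr hg)⟩,
        fun h g hg => hg.elim (h.1 g) (h.2 g)⟩
    have hex : ∃ S, (∃ h ∈ H, h ⊆ S) ∧ ∀ g ∈ GJ ∪ G', ¬ g ⊆ S :=
      ⟨T, sqm_mem_span_iff.mp hT.1, hU.mpr ⟨hT.2, hTG⟩⟩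
    have hside : ∀ {f m : Finset (Fin n)},
        ((∀ g ∈ G', ¬ g ⊆ f) → f ⊆ m ∧ m ∈ degSet I J (d + 1) ∧ ∀ g ∈ G', ¬ g ⊆ m) →
        (∀ g ∈ GJ ∪ G', ¬ g ⊆ f) → f ⊆ m ∧ m.card = d + 1 ∧ ∀ g ∈ GJ ∪ G', ¬ g ⊆ m := fun h hf =>
      have h' := h (hU.mp hf).2
      ⟨h'.1, h'.2.1.2, hU.mpr ⟨h'.2.1.1.2, h'.2.2⟩⟩
    have hdepth : d + 1 ≤ depthIJ I (J ⊔ Ideal.span (sqm K '' G')) := by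
      rw [hsup]
      rcases h₁₂ with h₁₂ | h₁₂
      · exact succ_le_depthIJ hf2 hf1 hfH₂ hfH₁ (fun h hh h2 h1 => hH h hh h1 h2) hHG hex
          (hside h₂) fun hf => ⟨(hside h₁ hf).1, (hside h₁ hf).2.1, (hside h₁ hf).2.2,
            h₁₂ (hU.mp hf).2⟩
      · exact succ_le_depthIJ hf1 hf2 hfH₁ hfH₂ hH hHG hex
          (hside h₁) fun hf => ⟨(hside h₂ hf).1, (hside h₂ hf).2.1, (hside h₂ hf).2.2,
            h₁₂ (hU.mp hf).2⟩
    by_contra hlt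
    exact absurd hdepth (not_le.mpr (hno G' hG' (span_sqm_ne_bot hG'ne)
      (span_sqm_lt (fun g hg => (hG'P g hg).1) hT.1 hTG) (by omega)))
  have hinter : ∀ w ∈ degSet I J (d + 1), f₁ ⊆ w → f₂ ⊆ w → ∀ w' ∈ degSet I J (d + 1), f₁ ⊆ w' →
      f₂ ⊆ w' → w = w' := fun w hw h1 h2 w' hw' h1' h2' =>
    (union_eq_of_card_eq_add_one hf1 hf2 hw.2 hne h1 h2).symm.trans
      (union_eq_of_card_eq_add_one hf1 hf2 hw'.2 hne h1' h2')
  have hV : ∀ f b, b ∈ B.filter (f ⊆ ·) ↔ b ∈ degSet I J (d + 1) ∧ f ⊆ b := fun f b => by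
    rw [Finset.mem_filter, hB]
  have hUB : ∀ {U : Finset (Finset (Fin n))}, U ⊆ B → ∀ u ∈ U, u ∈ degSet I J (d + 1) :=
    fun hU u hu => (hB u).mp (hU hu)
  have hUns : ∀ {U : Finset (Finset (Fin n))}, U ⊆ B → ∀ m ∈ degSet I J (d + 1), m ∉ U →
      ∀ g ∈ U, ¬ g ⊆ m := fun hU m hm hmU g hg =>
    hns m hm g (hUB hU g hg) fun h => hmU (h ▸ hg)
  have hm₁ : ∀ U ⊆ B, B.filter (f₁ ⊆ ·) ⊆ U → ¬ B.filter (f₂ ⊆ ·) ⊆ U →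
      ∃ a ∈ degSet I J (d + 1), f₁ ⊆ a ∧ ∃ b ∈ degSet I J (d + 1), f₁ ⊆ b ∧ a ≠ b ∧
        ∃ c ∈ degMultiples I J (d + 2) a, c ∈ degMultiples I J (d + 2) b ∧
          Matches (degMultiples I J (d + 2)) (U \ {a, b}) {c} := by
    intro U hU hVU hVU'
    obtain ⟨m, hm, hmU⟩ := Finset.not_subset.mp hVU'
    obtain ⟨hm, hfm⟩ := (hV f₂ m).mp hm
    have hfm' : ¬ f₁ ⊆ m := fun h => hmU (hVU ((hV f₁ m).mpr ⟨hm, h⟩))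
    have hmG : ∀ g ∈ insert f₁ (U : Set (Finset (Fin n))), ¬ g ⊆ m := by
      rintro g (rfl | hg)
      exacts [hfm', hUns hU m hm hmU g hg]
    refine exists_pair_matches_of_le_sdepth hP₁ (hUB hU) (key _ ?_ (Set.insert_nonempty _ _) m hm.1
      hmG m m (fun h => absurd subset_rfl (h f₁ (Set.mem_insert _ _))) (fun _ => ⟨hfm, hm, hmG⟩)
      (Or.inr fun _ => hfm'))
    rintro g (rfl | hg)
    exacts [Or.inl (Or.inl rfl), Or.inr (hUB hU g hg)]
  have hm₂ : ∀ U ⊆ B, B.filter (f₂ ⊆ ·) ⊆ U → ¬ B.filter (f₁ ⊆ ·) ⊆ U →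
      ∃ a ∈ degSet I J (d + 1), f₂ ⊆ a ∧ ∃ b ∈ degSet I J (d + 1), f₂ ⊆ b ∧ a ≠ b ∧
        ∃ c ∈ degMultiples I J (d + 2) a, c ∈ degMultiples I J (d + 2) b ∧
          Matches (degMultiples I J (d + 2)) (U \ {a, b}) {c} := by
    intro U hU hVU hVU'
    obtain ⟨m, hm, hmU⟩ := Finset.not_subset.mp hVU'
    obtain ⟨hm, hfm⟩ := (hV f₁ m).mp hm
    have hfm' : ¬ f₂ ⊆ m := fun h => hmU (hVU ((hV f₂ m).mpr ⟨hm, h⟩))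
    have hmG : ∀ g ∈ insert f₂ (U : Set (Finset (Fin n))), ¬ g ⊆ m := by
      rintro g (rfl | hg)
      exacts [hfm', hUns hU m hm hmU g hg]
    refine exists_pair_matches_of_le_sdepth hP₂ (hUB hU) (key _ ?_ (Set.insert_nonempty _ _) m hm.1
      hmG m m (fun _ => ⟨hfm, hm, hmG⟩) (fun h => absurd subset_rfl (h f₂ (Set.mem_insert _ _)))
      (Or.inl fun _ => hfm'))
    rintro g (rfl | hg)
    exacts [Or.inl (Or.inr rfl), Or.inr (hUB hU g hg)]
  have hns₁ : ¬ B.filter (f₁ ⊆ ·) ⊆ B.filter (f₂ ⊆ ·) := by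
    obtain ⟨b, hb, hb₁, hb₂, -⟩ := hb
    rw [← Set.image_singleton, sqm_mem_span_iff] at hb₁ hb₂
    exact fun h => hb₂ ⟨f₂, rfl, ((hV f₂ b).mp (h ((hV f₁ b).mpr ⟨hb, by simpa using hb₁⟩))).2⟩
  have hpair : ∀ f ∈ degSet I J d, ∀ a ∈ B.filter (f ⊆ ·), ∀ c ∈ degMultiples I J (d + 2) a,
      ∃ b ∈ B.filter (f ⊆ ·), b ≠ a ∧ c ∈ degMultiples I J (d + 2) b := by
    intro f hf a ha c hc
    obtain ⟨ha, hfa⟩ := (hV f a).mp ha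
    obtain ⟨b, hb, hfb, hba, hcb⟩ := pair_of_mem_degMultiples hf ha hfa hc
    exact ⟨b, (hV f b).mpr ⟨hb, hfb⟩, hba, hcb⟩
  have huniq : ∀ f, ∀ a ∈ B.filter (f ⊆ ·), ∀ b ∈ B.filter (f ⊆ ·), a ≠ b →
      ∀ c ∈ degMultiples I J (d + 2) a, c ∈ degMultiples I J (d + 2) b →
      ∀ c' ∈ degMultiples I J (d + 2) a, c' ∈ degMultiples I J (d + 2) b → c = c' := by
    intro f a ha b hb hab c hca hcb c' hca' hcb'
    have ha := ((hV f a).mp ha).1.2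
    have hb := ((hV f b).mp hb).1.2
    rw [mem_degMultiples] at hca hcb hca' hcb'
    exact (union_eq_of_card_eq_add_one ha hb hca.2.2 hab hca.1 hcb.1).symm.trans
      (union_eq_of_card_eq_add_one ha hb hca'.2.2 hab hca'.1 hcb'.1)
  refine hsd.not_ge (le_sdepth_of_pairSolution hP₁ hP₂ hne hP hB (PairSystem.solution
    { sub₁ := Finset.filter_subset _ _
      sub₂ := Finset.filter_subset _ _
      not_sub₁ := hns₁
      not_sub₂ := fun h => ?_
      inter := fun w hw₁ hw₂ w' hw₁' hw₂' => ?_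
      pair₁ := hpair f₁ hP₁
      pair₂ := hpair f₂ hP₂
      uniq₁ := huniq f₁
      uniq₂ := huniq f₂
      matches₀ := fun U hU u hu huU m hm hmU hum => ?_
      matches₁ := fun U hU hVU hVU' => ?_
      matches₂ := fun U hU hVU hVU' => ?_
      large := fun w hw₁ hw₂ => ?_ }))
  · obtain ⟨a, ha, hfa, b, hb, hfb, hab, -⟩ := hm₂ _ (Finset.filter_subset _ _) subset_rfl hns₁
    exact hab (hinter a ha ((hV f₁ a).mp (h ((hV f₂ a).mpr ⟨ha, hfa⟩))).2 hfa b hb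
      ((hV f₁ b).mp (h ((hV f₂ b).mpr ⟨hb, hfb⟩))).2 hfb)
  · rw [hV] at hw₁ hw₂ hw₁' hw₂'
    exact hinter w hw₁.1 hw₁.2 hw₂.2 w' hw₁'.1 hw₁'.2 hw₂'.2
  · obtain ⟨hu, hfu⟩ := (hV f₁ u).mp hu
    obtain ⟨hm, hfm⟩ := (hV f₂ m).mp hm
    rcases U.eq_empty_or_nonempty with rfl | hUne
    · exact ⟨id, by simp, by simp⟩
    refine matches_of_le_sdepth (hUB hU) (key _ (fun g hg => Or.inr (hUB hU g hg)) hUne u hu.1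
      (hUns hU u hu huU) u m (fun _ => ⟨hfu, hu, hUns hU u hu huU⟩)
      (fun _ => ⟨hfm, hm, hUns hU m hm hmU⟩) ?_)
    by_contra! hcon
    exact hum (hinter u hu hfu hcon.1.2 m hm hcon.2.2 hfm)
  · obtain ⟨a, ha, hfa, b, hb, hfb, h⟩ := hm₁ U hU hVU hVU'
    exact ⟨a, (hV f₁ a).mpr ⟨ha, hfa⟩, b, (hV f₁ b).mpr ⟨hb, hfb⟩, h⟩
  · obtain ⟨a, ha, hfa, b, hb, hfb, h⟩ := hm₂ U hU hVU hVU'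
    exact ⟨a, (hV f₂ a).mpr ⟨ha, hfa⟩, b, (hV f₂ b).mpr ⟨hb, hfb⟩, h⟩
  · by_contra! hcard
    have hunion : (B.filter (f₁ ⊆ ·) ∪ B.filter (f₂ ⊆ ·)).card < B.card := by
      have h1 := Finset.card_union_add_card_inter (B.filter (f₁ ⊆ ·)) (B.filter (f₂ ⊆ ·))
      have h2 := Finset.card_pos.mpr ⟨w, Finset.mem_inter.mpr ⟨hw₁, hw₂⟩⟩
      omega
    obtain ⟨e, heB, heV⟩ := Finset.exists_mem_notMem_of_card_lt_card hunion
    rw [Finset.mem_union, not_or, hV, hV, ← hB, not_and, not_and] at heV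
    have heG : ∀ g ∈ insert f₁ (insert f₂ (degSet I J (d + 1) \ {e})), ¬ g ⊆ e := by
      rintro g (rfl | rfl | hg)
      · exact heV.1 heB
      · exact heV.2 heB
      · exact hns e ((hB e).mp heB) g hg.1 fun h => hg.2 h.symm
    have hf₁G := Set.mem_insert f₁ (insert f₂ (degSet I J (d + 1) \ {e}))
    have hf₂G := Set.mem_insert_of_mem f₁ (Set.mem_insert f₂ (degSet I J (d + 1) \ {e}))
    obtain ⟨a₁, ha₁, b₁, hb₁, a₂, ha₂, b₂, hb₂, hfa₁, hfb₁, hab₁, hfa₂, hfb₂, hab₂, hw⟩ :=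
      exists_disjoint_pairs_of_le_sdepth hP₁ hP₂ hne (fun u hu => hu.1) (key _ (by
        rintro g (rfl | rfl | hg)
        exacts [Or.inl (Or.inl rfl), Or.inl (Or.inr rfl), Or.inr hg.1])
        (Set.insert_nonempty _ _) e ((hB e).mp heB).1 heG e e
        (fun h => absurd subset_rfl (h f₁ hf₁G)) (fun h => absurd subset_rfl (h f₂ hf₂G))
        (Or.inl fun h => absurd subset_rfl (h f₁ hf₁G)))
    have hpairV : ∀ {f a b : Finset (Fin n)}, a ∈ degSet I J (d + 1) → b ∈ degSet I J (d + 1) →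
        f ⊆ a → f ⊆ b → a ≠ b → (B.filter (f ⊆ ·)).card < 3 → w ∈ B.filter (f ⊆ ·) →
        w = a ∨ w = b := by
      intro f a b ha hb hfa hfb hab hcard hw
      have heq := Finset.eq_of_subset_of_card_le (s := {a, b}) (t := B.filter (f ⊆ ·))
        (Finset.insert_subset ((hV f a).mpr ⟨ha, hfa⟩)
          (Finset.singleton_subset_iff.mpr ((hV f b).mpr ⟨hb, hfb⟩)))
        (by rw [Finset.card_pair hab]; omega)
      simpa [← heq] using hw
    exact hw w (hpairV ha₁ hb₁ hfa₁ hfb₁ hab₁ hcard.1 hw₁)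
      (hpairV ha₂ hb₂ hfa₂ hfb₂ hab₂ hcard.2 hw₂)
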